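/- (Laver) If κ is a supercompact cardinal, then the Laver diamond principle LD^sc_κ holds; that is, there is a partial function ℓ : κ ⇀ V_κ such that for every cardinal θ and every set A ∈ H(θ⁺) there is a θ-supercompactness embedding j : V → M with critical point κ such that j(ℓ)(κ) = A. -/

import Mathlib

open FirstOrder

universe u

namespace LaverDiamond

/-- The relation symbols of the language of set theory: a single binary relation `mem`. -/
inductive memRel : ℕ → Type
  | mem : memRel 2

/-- The first-order language of set theory. -/
def SetLang : FirstOrder.Language := ⟨fun _ => Empty, memRel⟩

/-- Any class of ZF-sets is a structure in the language of set theory, with the true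
membership relation. -/
instance classStructure (M : Set ZFSet.{u}) : SetLang.Structure M where
  funMap := fun {_} f _ => f.elim
  RelMap := fun {_} r x => match r with
    | .mem => (x 0 : ZFSet) ∈ (x 1 : ZFSet)

/-- A (fully) elementary embedding from the class `M` to the class `N`, both classes of
ZF-sets equipped with the true membership relation.  It is coded by a global function
`j : ZFSet → ZFSet` mapping `M` into `N`, elementary for all first-order formulas
with parameters from `M`. -/
structure ClassEmb (M N : Set ZFSet.{u}) where
  j : ZFSet.{u} → ZFSet.{u}
  maps : ∀ x, x ∈ M → j x ∈ N
  elem : ∀ {n : ℕ} (φ : SetLang.Formula (Fin n)) (v : Fin n → ZFSet.{u}) (hv : ∀ i, v i ∈ M),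
    φ.Realize (fun i => (⟨v i, hv i⟩ : M)) ↔ φ.Realize (fun i => (⟨j (v i), maps _ (hv i)⟩ : N))

/-- The universe of all ZF-sets, as a class. -/
def V : Set ZFSet.{u} := Set.univ

/-- A transitive class of ZF-sets. -/
def TransClass (M : Set ZFSet.{u}) : Prop := ∀ x ∈ M, ∀ y ∈ x, y ∈ M

/-- `j` has critical point `κ`: `κ` is an ordinal, fixed below `κ`, with `j(κ) > κ`. -/
def CritPt (j : ZFSet.{u} → ZFSet.{u}) (κ : ZFSet.{u}) : Prop :=
  κ.IsOrdinal ∧ κ ∈ j κ ∧ ∀ α : ZFSet, α.IsOrdinal → α ∈ κ → j α = α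

/-- `x` is a member of the rank-initial segment `V_θ`. -/
def MemV (θ x : ZFSet.{u}) : Prop := x.rank < θ.rank

/-- `κ` is a cardinal: an ordinal not equinumerous with any smaller ordinal. -/
def IsCard (κ : ZFSet.{u}) : Prop :=
  κ.IsOrdinal ∧ ∀ β ∈ κ, Cardinal.mk β.toSet < Cardinal.mk κ.toSet

/-- `x ∈ H(θ⁺)`, i.e. `x` has hereditary size at most `θ`. -/
def MemH (θ x : ZFSet.{u}) : Prop :=
  ∃ t : ZFSet, t.IsTransitive ∧ x ∈ t ∧ Cardinal.mk t.toSet ≤ Cardinal.mk θ.toSet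

/-- `f` is a set-function with domain `θ` taking values in the class `M`. -/
def IsFuncInto (θ : ZFSet.{u}) (M : Set ZFSet.{u}) (f : ZFSet.{u}) : Prop :=
  (∀ p ∈ f, ∃ a b : ZFSet, a ∈ θ ∧ b ∈ M ∧ p = ZFSet.pair a b) ∧
  ∀ a ∈ θ, ∃! b : ZFSet, ZFSet.pair a b ∈ f

/-- The class `M` is closed under `θ`-sequences: `M^θ ⊆ M`. -/
def SeqClosed (θ : ZFSet.{u}) (M : Set ZFSet.{u}) : Prop :=
  ∀ f : ZFSet, IsFuncInto θ M f → f ∈ M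

/-- The set `M` is closed under `<κ`-sequences: `M^{<κ} ⊆ M`. -/
def SeqClosedLt (κ M : ZFSet.{u}) : Prop :=
  ∀ α : ZFSet, α ∈ κ → ∀ f : ZFSet, IsFuncInto α M.toSet f → f ∈ M

/-- `ℓ` is a partial function from `κ` to `V_κ` (coded as a set of Kuratowski pairs). -/
def IsPFun (κ ℓ : ZFSet.{u}) : Prop :=
  (∀ p ∈ ℓ, ∃ γ A : ZFSet, γ ∈ κ ∧ MemV κ A ∧ p = ZFSet.pair γ A) ∧
  ∀ γ A B : ZFSet, ZFSet.pair γ A ∈ ℓ → ZFSet.pair γ B ∈ ℓ → A = B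

/-- The set `r` is the restriction to `κ` of the class function `ℓ` (defined on the
ordinals below `κ`), coded as a set of Kuratowski pairs. -/
def RestrictEq (ℓ : ZFSet.{u} → ZFSet.{u}) (κ r : ZFSet.{u}) : Prop :=
  ∀ p : ZFSet, p ∈ r ↔ ∃ γ : ZFSet, γ ∈ κ ∧ p = ZFSet.pair γ (ℓ γ)

/-- The set `r` is the restriction to `κ` of the class function `ℓ` restricted further to
the class `D`. -/
def RestrictEqOn (ℓ : ZFSet.{u} → ZFSet.{u}) (D : Set ZFSet.{u}) (κ r : ZFSet.{u}) : Prop :=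
  ∀ p : ZFSet, p ∈ r ↔ ∃ γ : ZFSet, γ ∈ κ ∧ γ ∈ D ∧ p = ZFSet.pair γ (ℓ γ)

/-- The set `r` is the restriction to `δ` of the set partial function `ℓ`. -/
def RestrictSet (ℓ δ r : ZFSet.{u}) : Prop :=
  ∀ p : ZFSet, p ∈ r ↔ p ∈ ℓ ∧ ∃ γ A : ZFSet, γ ∈ δ ∧ p = ZFSet.pair γ A

/-! ### Supercompactness -/

/-- A `θ`-supercompactness embedding with critical point `κ`: an elementary embedding
`j : V → M` with `M` a transitive class closed under `θ`-sequences and `j(κ) > θ`. -/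
structure SCEmb (κ θ : ZFSet.{u}) where
  M : Set ZFSet.{u}
  trans : TransClass M
  e : ClassEmb V M
  crit : CritPt e.j κ
  closed : SeqClosed θ M
  big : θ ∈ e.j κ

/-- `κ` is `θ`-supercompact. -/
def SCAt (κ θ : ZFSet.{u}) : Prop := Nonempty (SCEmb κ θ)

/-- `κ` is supercompact: `θ`-supercompact for every cardinal `θ`. -/
def Supercompact (κ : ZFSet.{u}) : Prop := ∀ θ : ZFSet, IsCard θ → SCAt κ θ

/-- `ℓ` is a Laver function witnessing the Laver diamond `LD^sc_κ`. -/
def LDscFun (κ ℓ : ZFSet.{u}) : Prop :=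
  IsPFun κ ℓ ∧ ∀ θ A : ZFSet, IsCard θ → MemH θ A →
    ∃ E : SCEmb κ θ, ZFSet.pair κ A ∈ E.e.j ℓ

/-- The Laver diamond principle `LD^sc_κ`. -/
def LDsc (κ : ZFSet.{u}) : Prop := ∃ ℓ : ZFSet, LDscFun κ ℓ

/-- A universal `LD^sc` Laver function. -/
def UnivLDsc (ℓ : ZFSet.{u} → ZFSet.{u}) : Prop :=
  ∀ κ : ZFSet, Supercompact κ → ∃ r : ZFSet, RestrictEq ℓ κ r ∧ LDscFun κ r

/-! ### Strongness -/

/-- A `θ`-strongness embedding with critical point `κ`: an elementary `j : V → M` with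
`M` a transitive class and `V_θ ⊆ M`. -/
structure StrEmb (κ θ : ZFSet.{u}) where
  M : Set ZFSet.{u}
  trans : TransClass M
  e : ClassEmb V M
  crit : CritPt e.j κ
  vsub : ∀ x : ZFSet, MemV θ x → x ∈ M

/-- `κ` is `θ`-strong. -/
def StrongAt (κ θ : ZFSet.{u}) : Prop := Nonempty (StrEmb κ θ)

/-- `κ` is a strong cardinal. -/
def Strong (κ : ZFSet.{u}) : Prop := ∀ θ : ZFSet, θ.IsOrdinal → StrongAt κ θ

/-- `ℓ` witnesses the Laver diamond `LD^strong_κ`. -/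
def LDstrongFun (κ ℓ : ZFSet.{u}) : Prop :=
  IsPFun κ ℓ ∧ ∀ θ A : ZFSet, θ.IsOrdinal → MemV θ A →
    ∃ E : StrEmb κ θ, ZFSet.pair κ A ∈ E.e.j ℓ

/-- The Laver diamond principle `LD^strong_κ`. -/
def LDstrong (κ : ZFSet.{u}) : Prop := ∃ ℓ : ZFSet, LDstrongFun κ ℓ

/-- A universal `LD^strong` Laver function. -/
def UnivLDstrong (ℓ : ZFSet.{u} → ZFSet.{u}) : Prop :=
  ∀ κ : ZFSet, Strong κ → ∃ r : ZFSet, RestrictEq ℓ κ r ∧ LDstrongFun κ r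

/-! ### Measurability -/

/-- An embedding witnessing measurability of `κ`: an elementary `j : V → M`
with `M` a transitive class and critical point `κ`. -/
structure MeasEmb (κ : ZFSet.{u}) where
  M : Set ZFSet.{u}
  trans : TransClass M
  e : ClassEmb V M
  crit : CritPt e.j κ

/-- `κ` is a measurable cardinal. -/
def MeasurableCard (κ : ZFSet.{u}) : Prop := Nonempty (MeasEmb κ)

/-- `ℓ` witnesses the Laver diamond `LD^meas_κ`. -/
def LDmeasFun (κ ℓ : ZFSet.{u}) : Prop :=
  IsPFun κ ℓ ∧ ∀ A : ZFSet, MemH κ A → ∃ E : MeasEmb κ, ZFSet.pair κ A ∈ E.e.j ℓ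

/-- The Laver diamond principle `LD^meas_κ`. -/
def LDmeas (κ : ZFSet.{u}) : Prop := ∃ ℓ : ZFSet, LDmeasFun κ ℓ

/-- A universal `LD^meas` Laver function. -/
def UnivLDmeas (ℓ : ZFSet.{u} → ZFSet.{u}) : Prop :=
  ∀ κ : ZFSet, MeasurableCard κ → ∃ r : ZFSet, RestrictEq ℓ κ r ∧ LDmeasFun κ r

/-! ### Weak compactness -/

/-- `κ` is weakly compact: every transitive set `M` of size `κ` with `κ ∈ M` admits an
elementary embedding `j : M → N` into a transitive set `N` with critical point `κ`. -/
def WeaklyCompact (κ : ZFSet.{u}) : Prop :=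
  ∀ M : ZFSet, M.IsTransitive → Cardinal.mk M.toSet = Cardinal.mk κ.toSet → κ ∈ M →
    ∃ N : ZFSet, N.IsTransitive ∧ ∃ e : ClassEmb M.toSet N.toSet, CritPt e.j κ

/-- `ℓ` witnesses the Laver diamond `LD^wc_κ`. -/
def LDwcFun (κ ℓ : ZFSet.{u}) : Prop :=
  IsPFun κ ℓ ∧ ∀ A M : ZFSet, MemH κ A →
    M.IsTransitive → Cardinal.mk M.toSet = Cardinal.mk κ.toSet → κ ∈ M → A ∈ M → ℓ ∈ M →
    ∃ N : ZFSet, N.IsTransitive ∧ ∃ e : ClassEmb M.toSet N.toSet,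
      CritPt e.j κ ∧ ZFSet.pair κ A ∈ e.j ℓ

/-- The Laver diamond principle `LD^wc_κ`. -/
def LDwc (κ : ZFSet.{u}) : Prop := ∃ ℓ : ZFSet, LDwcFun κ ℓ

/-- A universal `LD^wc` Laver function. -/
def UnivLDwc (ℓ : ZFSet.{u} → ZFSet.{u}) : Prop :=
  ∀ κ : ZFSet, WeaklyCompact κ → ∃ r : ZFSet, RestrictEq ℓ κ r ∧ LDwcFun κ r

/-! ### Nice structures and unfoldability -/

/-- `M` is a nice structure for `κ`: a transitive set of size `κ`, closed under
`<κ`-sequences, with `κ ∈ M`. -/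
def Nice (κ M : ZFSet.{u}) : Prop :=
  M.IsTransitive ∧ Cardinal.mk M.toSet = Cardinal.mk κ.toSet ∧ SeqClosedLt κ M ∧ κ ∈ M

/-- `κ` is unfoldable: for every ordinal `θ`, every nice structure admits a
`θ`-unfoldability embedding. -/
def Unfoldable (κ : ZFSet.{u}) : Prop :=
  ∀ θ M : ZFSet, θ.IsOrdinal → Nice κ M →
    ∃ N : ZFSet, N.IsTransitive ∧ ∃ e : ClassEmb M.toSet N.toSet, CritPt e.j κ ∧ θ ∈ e.j κ

/-- `ℓ` witnesses the Laver diamond `LD^unf_κ`. -/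
def LDunfFun (κ ℓ : ZFSet.{u}) : Prop :=
  IsPFun κ ℓ ∧ ∀ θ A M : ZFSet, θ.IsOrdinal → MemH κ A →
    M.IsTransitive → Cardinal.mk M.toSet = Cardinal.mk κ.toSet → SeqClosedLt κ M →
    κ ∈ M → ℓ ∈ M → A ∈ M →
    ∃ N : ZFSet, N.IsTransitive ∧ ∃ e : ClassEmb M.toSet N.toSet,
      CritPt e.j κ ∧ θ ∈ e.j κ ∧ ZFSet.pair κ A ∈ e.j ℓ

/-- The Laver diamond principle `LD^unf_κ`. -/
def LDunf (κ : ZFSet.{u}) : Prop := ∃ ℓ : ZFSet, LDunfFun κ ℓ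

/-- `ℓ` witnesses the Laver diamond `LD^sunf_κ` for strong unfoldability. -/
def LDsunfFun (κ ℓ : ZFSet.{u}) : Prop :=
  IsPFun κ ℓ ∧ ∀ θ A M : ZFSet, IsCard θ → MemH θ A →
    M.IsTransitive → Cardinal.mk M.toSet = Cardinal.mk κ.toSet → SeqClosedLt κ M →
    κ ∈ M → ℓ ∈ M →
    ∃ N : ZFSet, N.IsTransitive ∧ (∀ x : ZFSet, MemV θ x → x ∈ N) ∧
      ∃ e : ClassEmb M.toSet N.toSet, CritPt e.j κ ∧ θ ∈ e.j κ ∧ ZFSet.pair κ A ∈ e.j ℓ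

/-! ### Ramsey cardinals -/

/-- `F` is a weakly amenable `M`-normal measure on `κ`. -/
def MNormalMeasure (κ M F : ZFSet.{u}) : Prop :=
  (∀ X ∈ F, X ⊆ κ ∧ X ∈ M) ∧ κ ∈ F ∧ (∅ : ZFSet) ∉ F ∧
  (∀ X Y : ZFSet, X ∈ F → Y ∈ F → X ∩ Y ∈ F) ∧
  (∀ X Y : ZFSet, X ∈ F → Y ∈ M → X ⊆ Y → Y ⊆ κ → Y ∈ F) ∧
  (∀ X : ZFSet, X ∈ M → X ⊆ κ → (X ∈ F ∨ κ \ X ∈ F)) ∧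
  (∀ ξ ∈ κ, ({ξ} : ZFSet) ∉ F) ∧
  (∀ γ f : ZFSet, γ ∈ κ → f ∈ M → IsFuncInto γ F.toSet f →
    ZFSet.sep (fun ξ => ∀ a X : ZFSet, ZFSet.pair a X ∈ f → ξ ∈ X) κ ∈ F) ∧
  (∀ f : ZFSet, f ∈ M → IsFuncInto κ F.toSet f →
    ZFSet.sep (fun ξ => ∀ a X : ZFSet, ZFSet.pair a X ∈ f → a ∈ ξ → ξ ∈ X) κ ∈ F) ∧
  (∀ D : ZFSet, D ∈ M → MemH κ D → F ∩ D ∈ M)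

/-- `j` is (isomorphic to) the ultrapower map of `M` by the `M`-measure `F` on `κ`, with
transitive (wellfounded) target `N`: `j` is elementary, has critical point `κ`, derives the
measure `F` at `κ`, and every element of `N` has the form `j(f)(κ)` for some function
`f ∈ M` with domain `κ`. -/
def IsUltrapowerMap (κ M F N : ZFSet.{u}) (j : ZFSet.{u} → ZFSet.{u}) : Prop :=
  N.IsTransitive ∧ (∃ e : ClassEmb M.toSet N.toSet, e.j = j) ∧ CritPt j κ ∧
  (∀ X : ZFSet, X ∈ M → X ⊆ κ → (X ∈ F ↔ κ ∈ j X)) ∧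
  (∀ y ∈ N, ∃ f : ZFSet, f ∈ M ∧ (∀ a ∈ κ, ∃! b : ZFSet, ZFSet.pair a b ∈ f) ∧
    ZFSet.pair κ y ∈ j f)

/-- A wellfounded iteration of `⟨M, F⟩` of length `δ`: a commuting system of elementary
embeddings between transitive models, starting at `⟨M, F⟩`, taking ultrapowers by the
image measures at successor steps and direct limits at limit stages. -/
structure Iteration (κ M F δ : ZFSet.{u}) where
  Mod : ZFSet.{u} → ZFSet.{u}
  Meas : ZFSet.{u} → ZFSet.{u}
  cp : ZFSet.{u} → ZFSet.{u}
  emb : ZFSet.{u} → ZFSet.{u} → ZFSet.{u} → ZFSet.{u}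
  mod_zero : Mod ∅ = M
  meas_zero : Meas ∅ = F
  cp_zero : cp ∅ = κ
  trans' : ∀ i : ZFSet, i ∈ δ → (Mod i).IsTransitive
  elem' : ∀ i k : ZFSet, i ∈ δ → k ∈ δ → i ∈ k →
    ∃ e : ClassEmb (Mod i).toSet (Mod k).toSet, e.j = emb i k
  comm : ∀ i k l : ZFSet, i ∈ δ → k ∈ δ → l ∈ δ → i ∈ k → k ∈ l →
    ∀ x ∈ Mod i, emb k l (emb i k x) = emb i l x
  cp_emb : ∀ i : ZFSet, i ∈ δ → i ≠ ∅ → cp i = emb ∅ i κ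
  succ' : ∀ i : ZFSet, i ∈ δ → insert i i ∈ δ →
    IsUltrapowerMap (cp i) (Mod i) (Meas i) (Mod (insert i i)) (emb i (insert i i)) ∧
    (∀ Y : ZFSet, Y ∈ Meas (insert i i) ↔
      ∃ D : ZFSet, D ∈ Mod i ∧ Y ∈ emb i (insert i i) (Meas i ∩ D))
  limit' : ∀ l : ZFSet, l ∈ δ → l ≠ ∅ → (∀ i ∈ l, insert i i ∈ l) →
    (∀ y ∈ Mod l, ∃ i : ZFSet, i ∈ l ∧ ∃ x, x ∈ Mod i ∧ emb i l x = y) ∧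
    (∀ Y : ZFSet, Y ∈ Meas l ↔
      ∃ i : ZFSet, i ∈ l ∧ ∃ D, D ∈ Mod i ∧ Y ∈ emb i l (Meas i ∩ D))

/-- `⟨M, F⟩` is iterable: all its iterations (of any ordinal length) are wellfounded,
i.e. realized by transitive models. -/
def Iterable (κ M F : ZFSet.{u}) : Prop :=
  ∀ δ : ZFSet, δ.IsOrdinal → Nonempty (Iteration κ M F δ)

/-! ### Constructibility -/

/-- `X` is a subset of `M` definable over `⟨M, ∈⟩` with parameters. -/
def DefinableSubset (M X : ZFSet.{u}) : Prop :=
  X ⊆ M ∧ ∃ (n : ℕ) (φ : SetLang.Formula (Fin (n + 1))) (v : Fin n → ZFSet.{u})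
    (hv : ∀ i, v i ∈ M.toSet),
    ∀ a : ZFSet, a ∈ X ↔ ∃ ha : a ∈ M.toSet,
      φ.Realize (Fin.cons (⟨a, ha⟩ : M.toSet) (fun i => (⟨v i, hv i⟩ : M.toSet)))

/-- The set of all subsets of `M` definable over `⟨M, ∈⟩` with parameters. -/
noncomputable def DefSet (M : ZFSet.{u}) : ZFSet.{u} :=
  ZFSet.sep (fun X => DefinableSubset M X) (ZFSet.powerset M)

/-- `h` codes the constructible hierarchy up to `δ`: a function with domain `δ` such that
`h(β) = ⋃_{γ<β} Def(h(γ))` for every `β < δ`. -/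
def IsLHierarchy (δ h : ZFSet.{u}) : Prop :=
  δ.IsOrdinal ∧
  (∀ p ∈ h, ∃ β y : ZFSet, β ∈ δ ∧ p = ZFSet.pair β y) ∧
  (∀ β ∈ δ, ∃! y : ZFSet, ZFSet.pair β y ∈ h) ∧
  ∀ β y : ZFSet, ZFSet.pair β y ∈ h →
    ∀ z : ZFSet, z ∈ y ↔ ∃ γ x : ZFSet, γ ∈ β ∧ ZFSet.pair γ x ∈ h ∧ z ∈ DefSet x

/-- `x` is constructible: it appears at some level of some constructible hierarchy. -/
def Constructible (x : ZFSet.{u}) : Prop :=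
  ∃ δ h β y : ZFSet, IsLHierarchy δ h ∧ ZFSet.pair β y ∈ h ∧ x ∈ y

/-- The axiom of constructibility `V = L`. -/
def VeqL : Prop := ∀ x : ZFSet.{u}, Constructible x

/-! ### Normal measures -/

/-- `U` is a normal measure on `κ`: a `κ`-complete nonprincipal ultrafilter on `κ`
closed under diagonal intersections. -/
def IsNormalMeasure (κ U : ZFSet.{u}) : Prop :=
  (∀ X ∈ U, X ⊆ κ) ∧ κ ∈ U ∧ (∅ : ZFSet) ∉ U ∧
  (∀ X Y : ZFSet, X ∈ U → Y ∈ U → X ∩ Y ∈ U) ∧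
  (∀ X Y : ZFSet, X ∈ U → X ⊆ Y → Y ⊆ κ → Y ∈ U) ∧
  (∀ X : ZFSet, X ⊆ κ → (X ∈ U ∨ κ \ X ∈ U)) ∧
  (∀ ξ ∈ κ, ({ξ} : ZFSet) ∉ U) ∧
  (∀ γ f : ZFSet, γ ∈ κ → IsFuncInto γ U.toSet f →
    ZFSet.sep (fun ξ => ∀ a X : ZFSet, ZFSet.pair a X ∈ f → ξ ∈ X) κ ∈ U) ∧
  (∀ f : ZFSet, IsFuncInto κ U.toSet f →
    ZFSet.sep (fun ξ => ∀ a X : ZFSet, ZFSet.pair a X ∈ f → a ∈ ξ → ξ ∈ X) κ ∈ U)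

end LaverDiamond

namespace LaverDiamond

section

open Function

/-! ### Formulas of set theory with named variables -/

/-- Set-theoretic formulas with natural numbers as variables, including bounded quantifiers and
some absolute notions as primitives. -/
inductive Fml : Type
  | mem (i j : ℕ)
  | eq (i j : ℕ)
  | pairMem (i j k : ℕ)
  | eqPair (p i j : ℕ)
  | ord (i : ℕ)
  | neg (φ : Fml)
  | and (φ ψ : Fml)
  | all (i : ℕ) (φ : Fml)
  | ball (i j : ℕ) (φ : Fml)
  | allFst (i a e : ℕ) (φ : Fml)

namespace Fml

/-- Satisfaction of a formula in a class `M`. Only the unbounded quantifier refers to `M`; the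
other clauses are absolute for transitive classes. -/
def Sat (M : Set ZFSet.{u}) : Fml → (ℕ → ZFSet.{u}) → Prop
  | mem i j, v => v i ∈ v j
  | eq i j, v => v i = v j
  | pairMem i j k, v => ZFSet.pair (v i) (v j) ∈ v k
  | eqPair p i j, v => v p = ZFSet.pair (v i) (v j)
  | ord i, v => (v i).IsOrdinal
  | neg φ, v => ¬ Sat M φ v
  | and φ ψ, v => Sat M φ v ∧ Sat M ψ v
  | all i φ, v => ∀ x ∈ M, Sat M φ (update v i x)
  | ball i j φ, v => ∀ x ∈ v j, Sat M φ (update v i x)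
  | allFst i a e φ, v => ∀ x, ZFSet.pair x (v a) ∈ v e → Sat M φ (update v i x)

/-- Disjunction. -/
def or (φ ψ : Fml) : Fml := neg (and (neg φ) (neg ψ))
/-- Implication. -/
def imp (φ ψ : Fml) : Fml := neg (and φ (neg ψ))
/-- Equivalence. -/
def iff (φ ψ : Fml) : Fml := and (imp φ ψ) (imp ψ φ)
/-- Unbounded existential quantifier. -/
def ex (i : ℕ) (φ : Fml) : Fml := neg (all i (neg φ))
/-- Bounded existential quantifier. -/
def bex (i j : ℕ) (φ : Fml) : Fml := neg (ball i j (neg φ))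
/-- Existential quantifier over the first coordinates of pairs. -/
def exFst (i a e : ℕ) (φ : Fml) : Fml := neg (allFst i a e (neg φ))

section
variable (M : Set ZFSet.{u}) (v : ℕ → ZFSet.{u}) (i j k : ℕ) (φ ψ : Fml)

@[simp] theorem sat_mem : Sat M (mem i j) v ↔ v i ∈ v j := Iff.rfl
@[simp] theorem sat_eq : Sat M (eq i j) v ↔ v i = v j := Iff.rfl
@[simp] theorem sat_pairMem :
    Sat M (pairMem i j k) v ↔ ZFSet.pair (v i) (v j) ∈ v k := Iff.rfl
@[simp] theorem sat_eqPair :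
    Sat M (eqPair k i j) v ↔ v k = ZFSet.pair (v i) (v j) := Iff.rfl
@[simp] theorem sat_ord : Sat M (ord i) v ↔ (v i).IsOrdinal := Iff.rfl
@[simp] theorem sat_neg : Sat M (neg φ) v ↔ ¬ Sat M φ v := Iff.rfl
@[simp] theorem sat_and : Sat M (and φ ψ) v ↔ Sat M φ v ∧ Sat M ψ v := Iff.rfl
@[simp] theorem sat_all : Sat M (all i φ) v ↔ ∀ x ∈ M, Sat M φ (update v i x) := Iff.rfl
@[simp] theorem sat_ball :
    Sat M (ball i j φ) v ↔ ∀ x ∈ v j, Sat M φ (update v i x) := Iff.rfl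
@[simp] theorem sat_allFst : Sat M (allFst i j k φ) v ↔
    ∀ x, ZFSet.pair x (v j) ∈ v k → Sat M φ (update v i x) := Iff.rfl
@[simp] theorem sat_or : Sat M (or φ ψ) v ↔ Sat M φ v ∨ Sat M ψ v := by
  simp only [or, sat_neg, sat_and]; tauto
@[simp] theorem sat_imp : Sat M (imp φ ψ) v ↔ (Sat M φ v → Sat M ψ v) := by
  simp only [imp, sat_neg, sat_and]; tauto
@[simp] theorem sat_iff : Sat M (iff φ ψ) v ↔ (Sat M φ v ↔ Sat M ψ v) := by
  simp only [iff, sat_imp, sat_and]; tauto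
@[simp] theorem sat_ex : Sat M (ex i φ) v ↔ ∃ x ∈ M, Sat M φ (update v i x) := by
  simp [ex]
@[simp] theorem sat_bex : Sat M (bex i j φ) v ↔ ∃ x ∈ v j, Sat M φ (update v i x) := by
  simp [bex]
@[simp] theorem sat_exFst : Sat M (exFst i j k φ) v ↔
    ∃ x, ZFSet.pair x (v j) ∈ v k ∧ Sat M φ (update v i x) := by
  simp [exFst]

end

end Fml

/-- A family of predicates on assignments is first-order if it is defined in every transitive class
by one and the same first-order formula. -/
def FODef (P : Set ZFSet.{u} → (ℕ → ZFSet.{u}) → Prop) : Prop :=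
  ∃ ψ : SetLang.Formula ℕ, ∀ M : Set ZFSet.{u}, TransClass M → ∀ v : ℕ → M,
    ψ.Realize v ↔ P M (fun i => v i)

namespace FODef

variable {P Q : Set ZFSet.{u} → (ℕ → ZFSet.{u}) → Prop}

theorem congr (h : FODef P)
    (hPQ : ∀ M, TransClass M → ∀ v, (∀ i, v i ∈ M) → (P M v ↔ Q M v)) : FODef Q := by
  obtain ⟨ψ, hψ⟩ := h
  exact ⟨ψ, fun M hM v => (hψ M hM v).trans (hPQ M hM _ fun i => (v i).2)⟩

theorem mem (i j : ℕ) : FODef.{u} fun _ v => v i ∈ v j := by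
  let r : SetLang.Relations 2 := memRel.mem
  exact ⟨r.formula₂ (.var i) (.var j), fun M hM v => Language.Formula.realize_rel₂⟩

theorem eq (i j : ℕ) : FODef.{u} fun _ v => v i = v j := by
  refine ⟨Language.Term.equal (L := SetLang) (.var i) (.var j), fun M hM v => ?_⟩
  rw [Language.Formula.realize_equal]
  exact Subtype.ext_iff

theorem neg (h : FODef P) : FODef fun M v => ¬ P M v := by
  obtain ⟨ψ, hψ⟩ := h
  exact ⟨ψ.not, fun M hM v => by rw [Language.Formula.realize_not, hψ M hM]⟩

theorem and (h : FODef P) (h' : FODef Q) : FODef fun M v => P M v ∧ Q M v := by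
  obtain ⟨ψ, hψ⟩ := h
  obtain ⟨χ, hχ⟩ := h'
  exact ⟨ψ ⊓ χ, fun M hM v => by rw [Language.Formula.realize_inf, hψ M hM, hχ M hM]⟩

theorem all (i : ℕ) (h : FODef P) : FODef fun M v => ∀ x ∈ M, P M (update v i x) := by
  obtain ⟨ψ, hψ⟩ := h
  refine ⟨Language.Formula.iAlls Unit
    (Language.Formula.relabel (fun k => if k = i then Sum.inr () else Sum.inl k) ψ),
    fun M hM v => ?_⟩
  have key : ∀ w : Unit → M, (fun k : ℕ => (((Sum.elim v w) ∘
      (fun k => if k = i then Sum.inr () else Sum.inl k)) k : ZFSet)) =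
      update (fun k => (v k : ZFSet)) i (w ()) := by
    intro w
    funext k
    by_cases hk : k = i <;> simp [hk]
  simp only [Language.Formula.realize_iAlls, Language.Formula.realize_relabel, hψ M hM, key]
  exact ⟨fun h x hx => h fun _ => ⟨x, hx⟩, fun h w => h _ (w ()).2⟩

theorem or (h : FODef P) (h' : FODef Q) : FODef fun M v => P M v ∨ Q M v :=
  (h.neg.and h'.neg).neg.congr fun _ _ _ _ => by tauto

theorem imp (h : FODef P) (h' : FODef Q) : FODef fun M v => P M v → Q M v :=
  (h.and h'.neg).neg.congr fun _ _ _ _ => by tauto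

theorem ball {i j : ℕ} (hij : i ≠ j) (h : FODef P) :
    FODef fun M v => ∀ x ∈ v j, P M (update v i x) := by
  refine (((mem i j).imp h).all i).congr fun M hM v hv => ?_
  simp only [update_self, update_of_ne hij.symm]
  exact ⟨fun h x hx => h x (hM _ (hv j) x hx) hx, fun h x _ hx => h x hx⟩

theorem bex {i j : ℕ} (hij : i ≠ j) (h : FODef P) :
    FODef fun M v => ∃ x ∈ v j, P M (update v i x) :=
  (h.neg.ball hij).neg.congr fun _ _ _ _ => by simp

/-- `{x, y} = s` is first-order. -/
theorem eq_insert_singleton (i j s : ℕ) :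
    FODef.{u} fun _ v => v s = ({v i, v j} : ZFSet) := by
  set w := i + j + s + 1 with hw
  refine (((mem i s).and (mem j s)).and
    (ball (i := w) (j := s) (by lia) ((eq w i).or (eq w j)))).congr fun M hM v hv => ?_
  have hwi : i ≠ w := by lia
  have hwj : j ≠ w := by lia
  simp only [update_self, update_of_ne hwi, update_of_ne hwj]
  refine ⟨fun ⟨⟨h1, h2⟩, h3⟩ => ?_, fun h => ?_⟩
  · ext z
    rw [ZFSet.mem_pair]
    exact ⟨h3 z, by rintro (rfl | rfl) <;> assumption⟩
  · rw [h]
    simp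

theorem eq_pair (i j p : ℕ) : FODef.{u} fun _ v => v p = ZFSet.pair (v i) (v j) := by
  set s := i + j + p + 1 with hs
  have hsi : i ≠ s := by lia
  have hsj : j ≠ s := by lia
  have hsp : s ≠ p := by lia
  refine (((bex hsp (eq_insert_singleton i i s)).and (bex hsp (eq_insert_singleton i j s))).and
    (ball hsp ((eq_insert_singleton i i s).or (eq_insert_singleton i j s)))).congr
    fun M hM v hv => ?_
  simp only [update_self, update_of_ne hsi, update_of_ne hsj, ZFSet.pair]
  simp only [ZFSet.pair_eq_singleton, exists_eq_right]
  refine ⟨fun ⟨⟨h1, h2⟩, h3⟩ => ?_, fun h => ?_⟩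
  · ext z
    rw [ZFSet.mem_pair]
    exact ⟨h3 z, by rintro (rfl | rfl) <;> assumption⟩
  · rw [h]
    simp

theorem pairMem (i j k : ℕ) : FODef.{u} fun _ v => ZFSet.pair (v i) (v j) ∈ v k := by
  set p := i + j + k + 1 with hp
  have hpi : i ≠ p := by lia
  have hpj : j ≠ p := by lia
  have hpk : p ≠ k := by lia
  refine (bex hpk (eq_pair i j p)).congr fun M hM v hv => ?_
  simp [update_of_ne hpi, update_of_ne hpj]

theorem ord (i : ℕ) : FODef.{u} fun _ v => (v i).IsOrdinal := by
  have h1 : i ≠ i + 1 := by lia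
  have h2 : i ≠ i + 2 := by lia
  refine ((ball (i := i + 1) (j := i) (by lia) (ball (i := i + 2) (j := i + 1) (by lia)
    (mem (i + 2) i))).and
    (ball (i := i + 1) (j := i) (by lia) (ball (i := i + 2) (j := i + 1) (by lia)
      (ball (i := i + 3) (j := i + 2) (by lia) (mem (i + 3) (i + 1)))))).congr fun M hM v hv => ?_
  simp only [update_self, update_of_ne h1, update_of_ne h2, ne_eq,
    Nat.add_left_cancel_iff, Nat.reduceEqDiff, not_false_eq_true, update_of_ne]
  refine ⟨fun ⟨ht, ho⟩ => ⟨fun y hy z hz => ht y hy z hz, fun h1 h2 h3 => ho _ h3 _ h2 _ h1⟩,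
    fun h => ⟨fun x hx y hy => h.mem_trans hy hx, fun x hx y hy z hz => h.mem_trans' hz hy hx⟩⟩

theorem allFst {i a e : ℕ} (hia : i ≠ a) (hie : i ≠ e) (h : FODef P) :
    FODef fun M v => ∀ x, ZFSet.pair x (v a) ∈ v e → P M (update v i x) := by
  refine (((pairMem i a e).imp h).all i).congr fun M hM v hv => ?_
  simp only [update_self, update_of_ne hia.symm, update_of_ne hie.symm]
  refine ⟨fun h x hx => h x (hM {x} (hM _ (hM _ (hv e) _ hx) _ ?_) x ?_) hx,
    fun h x _ hx => h x hx⟩ <;> simp [ZFSet.pair]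

end FODef

/-- No bounded quantifier of the formula binds a variable occurring in its own bound. -/
def Fml.good : Fml → Bool
  | .neg φ => φ.good
  | .and φ ψ => φ.good && ψ.good
  | .all _ φ => φ.good
  | .ball i j φ => i != j && φ.good
  | .allFst i a e φ => i != a && i != e && φ.good
  | _ => true

theorem FODef.sat (φ : Fml) (hφ : φ.good) : FODef.{u} fun M v => φ.Sat M v := by
  induction φ with
  | mem i j => exact .mem i j
  | eq i j => exact .eq i j
  | pairMem i j k => exact .pairMem i j k
  | eqPair p i j => exact .eq_pair i j p
  | ord i => exact .ord i
  | neg φ ih => exact .neg (ih hφ)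
  | and φ ψ ih ih' =>
    simp only [Fml.good, Bool.and_eq_true] at hφ
    exact .and (ih hφ.1) (ih' hφ.2)
  | all i φ ih => exact .all i (ih hφ)
  | ball i j φ ih =>
    simp only [Fml.good, Bool.and_eq_true, bne_iff_ne] at hφ
    exact .ball hφ.1 (ih hφ.2)
  | allFst i a e φ ih =>
    simp only [Fml.good, Bool.and_eq_true, bne_iff_ne] at hφ
    exact .allFst hφ.1.1 hφ.1.2 (ih hφ.2)

theorem transClass_V : TransClass V.{u} := fun _ _ _ _ => Set.mem_univ _

@[simp] theorem mem_V (x : ZFSet.{u}) : x ∈ V.{u} := Set.mem_univ x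

theorem TransClass.of_pair {M : Set ZFSet.{u}} (hM : TransClass M) {x y : ZFSet.{u}}
    (h : ZFSet.pair x y ∈ M) : x ∈ M ∧ y ∈ M := by
  have h1 : ({x, y} : ZFSet) ∈ M := hM _ h _ (by simp [ZFSet.pair])
  exact ⟨hM _ h1 _ (by simp), hM _ h1 _ (by simp)⟩

theorem ClassEmb.realize_iff {M N : Set ZFSet.{u}} (e : ClassEmb M N) (φ : SetLang.Formula ℕ)
    (v : ℕ → M) :
    φ.Realize v ↔ φ.Realize (fun i => (⟨e.j (v i), e.maps _ (v i).2⟩ : N)) := by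
  let f := φ.freeVarFinset.equivFin
  have h := e.elem (φ.restrictFreeVar f) (fun i => v (f.symm i)) (fun i => (v (f.symm i)).2)
  unfold Language.Formula.Realize at h ⊢
  rw [Language.BoundedFormula.realize_restrictFreeVar v (by simp)] at h
  rw [h]
  exact Language.BoundedFormula.realize_restrictFreeVar _ (by simp)

theorem ClassEmb.sat_iff {M : Set ZFSet.{u}} (e : ClassEmb V M) (hM : TransClass M) (φ : Fml)
    (hφ : φ.good) (v : ℕ → ZFSet.{u}) : φ.Sat V v ↔ φ.Sat M (fun i => e.j (v i)) := by
  obtain ⟨ψ, hψ⟩ := FODef.sat.{u} φ hφ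
  have h := hψ V transClass_V (fun i => ⟨v i, mem_V _⟩)
  have h' := hψ M hM (fun i => ⟨e.j (v i), e.maps _ (mem_V _)⟩)
  exact h.symm.trans ((e.realize_iff ψ _).trans h')

end

section

open Function

/-! ### Codes of supercompactness embeddings -/

/-- Relative to the class `M`, the set `U` is a fine normal ultrafilter on a set `I` of subsets of
`T × T`, almost all of which are inverses of transitive collapses of subsets of `T`, and `ℓ` almost
always maps the collapse of `γ` to the collapse of `A`. -/
structure IsCode (M : Set ZFSet.{u}) (γ ℓ T A I U : ZFSet.{u}) : Prop where
  sub : ∀ e ∈ I, ∀ p ∈ e, ∃ b ∈ T, ∃ a ∈ T, p = ZFSet.pair b a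
  usub : ∀ X ∈ U, ∀ e ∈ X, e ∈ I
  inter : ∀ X ∈ U, ∀ Y ∈ U, ∀ Z ∈ M, (∀ e ∈ Z, e ∈ I) → (∀ e ∈ X, e ∈ Y → e ∈ Z) → Z ∈ U
  nonempty : ∀ X ∈ U, ∃ e ∈ X, e ∈ I
  ultra : ∀ X ∈ M, (∀ e ∈ X, e ∈ I) → ∀ Y ∈ M, (∀ e ∈ Y, e ∈ I) →
    (∀ e ∈ I, e ∈ X ∨ e ∈ Y) → X ∈ U ∨ Y ∈ U
  normal : ∀ f ∈ M, ∀ X ∈ U,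
    (∀ e ∈ X, ∃ a ∈ T, (∃ b, ZFSet.pair b a ∈ e) ∧ ZFSet.pair e a ∈ f) →
    ∃ a ∈ T, ∃ Y ∈ U, ∀ e ∈ Y, ZFSet.pair e a ∈ f
  fine : ∀ a ∈ T, ∃ X ∈ U, ∀ e ∈ X, ∃ b, ZFSet.pair b a ∈ e
  iso : ∃ X ∈ U, ∀ e ∈ X, ∀ a ∈ T, ∀ b, ZFSet.pair b a ∈ e →
    (∀ b' ∈ b, ∃ a' ∈ T, ZFSet.pair b' a' ∈ e) ∧
    ∀ a' ∈ T, ∀ b', ZFSet.pair b' a' ∈ e → (b' ∈ b ↔ a' ∈ a) ∧ (b' = b ↔ a' = a)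
  guess : ∃ X ∈ U, ∀ e ∈ X, ∃ δ ∈ γ, ZFSet.pair δ γ ∈ e ∧
    (∃ B, ZFSet.pair B A ∈ e ∧ ZFSet.pair δ B ∈ ℓ) ∧ ∀ α ∈ δ, ZFSet.pair α α ∈ e
  bound : ∀ a ∈ T, a.IsOrdinal → ∃ X ∈ U, ∀ e ∈ X, ∃ δ ∈ γ, ZFSet.pair δ a ∈ e

namespace Fml

/-- The formula expressing `IsCode`, with free variables `0, …, 5`. -/
def code : Fml :=
  and (ball 6 4 (ball 7 6 (bex 8 2 (bex 9 2 (eqPair 7 8 9))))) <|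
  and (ball 6 5 (ball 7 6 (mem 7 4))) <|
  and (ball 6 5 (ball 7 5 (all 8 (imp (ball 9 8 (mem 9 4))
    (imp (ball 9 6 (imp (mem 9 7) (mem 9 8))) (mem 8 5)))))) <|
  and (ball 6 5 (bex 7 6 (mem 7 4))) <|
  and (all 6 (imp (ball 7 6 (mem 7 4)) (all 8 (imp (ball 7 8 (mem 7 4))
    (imp (ball 7 4 (or (mem 7 6) (mem 7 8))) (or (mem 6 5) (mem 8 5))))))) <|
  and (all 6 (ball 7 5 (imp (ball 8 7 (bex 9 2 (and (exFst 10 9 8 (eq 10 10)) (pairMem 8 9 6))))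
    (bex 9 2 (bex 10 5 (ball 8 10 (pairMem 8 9 6))))))) <|
  and (ball 6 2 (bex 7 5 (ball 8 7 (exFst 9 6 8 (eq 9 9))))) <|
  and (bex 6 5 (ball 7 6 (ball 8 2 (allFst 9 8 7 (and (ball 10 9 (bex 11 2 (pairMem 10 11 7)))
    (ball 11 2 (allFst 10 11 7 (and (iff (mem 10 9) (mem 11 8))
      (iff (eq 10 9) (eq 11 8)))))))))) <|
  and (bex 6 5 (ball 7 6 (bex 8 0 (and (pairMem 8 0 7) (and
    (exFst 9 3 7 (pairMem 8 9 1)) (ball 9 8 (pairMem 9 9 7))))))) <|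
  ball 6 2 (imp (ord 6) (bex 7 5 (ball 8 7 (bex 9 0 (pairMem 9 6 8)))))

theorem sat_code (M : Set ZFSet.{u}) (v : ℕ → ZFSet.{u}) :
    code.Sat M v ↔ IsCode M (v 0) (v 1) (v 2) (v 3) (v 4) (v 5) := by
  simp [code]
  constructor
  · rintro ⟨h1, h2, h3, h4, h5, h6, h7, h8, h9, h10⟩
    exact ⟨h1, h2, h3, h4, h5, h6, h7, h8, h9, h10⟩
  · rintro ⟨h1, h2, h3, h4, h5, h6, h7, h8, h9, h10⟩
    exact ⟨h1, h2, h3, h4, h5, h6, h7, h8, h9, h10⟩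

end Fml

end

section

open Function Filter

/-! ### Wellfounded ultrapowers of the universe -/

namespace Ultrapower

variable {ι : Type (u + 1)} [Small.{u} ι] {F : Ultrafilter ι}

/-- A form of countable completeness of an ultrafilter. -/
def SigmaComplete (F : Ultrafilter ι) : Prop :=
  ∀ P : ℕ → ι → Prop, (∀ n, ∀ᶠ i in F, P n i) → ∃ i, ∀ n, P n i

omit [Small.{u} ι] in
theorem SigmaComplete.wf (hF : SigmaComplete F) :
    WellFounded fun f g : ι → ZFSet.{u} => ∀ᶠ i in F, f i ∈ g i := by
  refine wellFounded_iff_isEmpty_descending_chain.2 ⟨fun ⟨g, hg⟩ => ?_⟩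
  obtain ⟨i, hi⟩ := hF _ hg
  exact (wellFounded_iff_isEmpty_descending_chain.1 ZFSet.mem_wf).false ⟨fun n => g n i, hi⟩

instance (g : ι → ZFSet.{u}) (P : (ι → ZFSet.{u}) → Prop) :
    Small.{u} {s : ι → ZFSet.{u} // (∀ i, s i ∈ insert ∅ (g i)) ∧ P s} :=
  small_of_injective (β := ∀ i, ↥(insert ∅ (g i)))
    (f := fun s i => ⟨s.1 i, s.2.1 i⟩) fun _ _ h => Subtype.ext <| funext fun i =>
      congrArg Subtype.val (congrFun h i)

/-- The transitive collapse of the ultrapower of the universe. -/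
noncomputable def collapse (hF : SigmaComplete F) : (ι → ZFSet.{u}) → ZFSet.{u} :=
  hF.wf.fix fun g c => ZFSet.range
    (fun s : {s : ι → ZFSet.{u} // (∀ i, s i ∈ insert ∅ (g i)) ∧ ∀ᶠ i in F, s i ∈ g i} =>
      c s.1 s.2.2)

variable (hF : SigmaComplete F)

theorem mem_collapse_aux (g : ι → ZFSet.{u}) (x : ZFSet.{u}) : x ∈ collapse hF g ↔
    ∃ s : ι → ZFSet.{u}, (∀ i, s i ∈ insert ∅ (g i)) ∧ (∀ᶠ i in F, s i ∈ g i) ∧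
      collapse hF s = x := by
  rw [collapse, hF.wf.fix_eq, ZFSet.mem_range]
  simp [and_assoc]

theorem collapse_congr (f g : ι → ZFSet.{u}) (h : ∀ᶠ i in F, f i = g i) :
    collapse hF f = collapse hF g := by
  induction f using hF.wf.induction generalizing g with
  | _ f ih =>
  classical
  ext x
  rw [mem_collapse_aux, mem_collapse_aux]
  constructor
  · rintro ⟨s, -, hs, rfl⟩
    refine ⟨fun i => if s i ∈ g i then s i else ∅, fun i => ?_, ?_, (ih s hs _ ?_).symm⟩
    · by_cases hi : s i ∈ g i <;> simp [hi]
    · filter_upwards [h, hs] with i h1 h2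
      rw [h1] at h2
      simp [h2]
    · filter_upwards [h, hs] with i h1 h2
      rw [h1] at h2
      simp [h2]
  · rintro ⟨s, -, hs, rfl⟩
    have hs' : ∀ᶠ i in F, (if s i ∈ f i then s i else ∅) ∈ f i ∧
        (if s i ∈ f i then s i else ∅) = s i := by
      filter_upwards [h, hs] with i h1 h2
      rw [← h1] at h2
      simp [h2]
    refine ⟨fun i => if s i ∈ f i then s i else ∅, fun i => ?_, hs'.mono fun i hi => hi.1,
      ih _ (hs'.mono fun i hi => hi.1) _ (hs'.mono fun i hi => hi.2)⟩
    by_cases hi : s i ∈ f i <;> simp [hi]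

theorem mem_collapse (g : ι → ZFSet.{u}) (x : ZFSet.{u}) : x ∈ collapse hF g ↔
    ∃ s : ι → ZFSet.{u}, (∀ᶠ i in F, s i ∈ g i) ∧ collapse hF s = x := by
  classical
  rw [mem_collapse_aux]
  refine ⟨fun ⟨s, _, h⟩ => ⟨s, h⟩, fun ⟨s, hs, hx⟩ => ?_⟩
  have hs' : ∀ᶠ i in F, (if s i ∈ g i then s i else ∅) ∈ g i ∧
      (if s i ∈ g i then s i else ∅) = s i := by
    filter_upwards [hs] with i h2
    simp [h2]
  refine ⟨fun i => if s i ∈ g i then s i else ∅, fun i => ?_, hs'.mono fun i hi => hi.1,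
    (collapse_congr hF _ _ (hs'.mono fun i hi => hi.2)).trans hx⟩
  by_cases hi : s i ∈ g i <;> simp [hi]

theorem eventually_eq_of_collapse_eq (f g : ι → ZFSet.{u}) (h : collapse hF f = collapse hF g) :
    ∀ᶠ i in F, f i = g i := by
  induction f using hF.wf.induction generalizing g with
  | _ f ih =>
  by_contra hne
  have hne' : ∀ᶠ i in F, (∃ x ∈ f i, x ∉ g i) ∨ ∃ x ∈ g i, x ∉ f i := by
    filter_upwards [Ultrafilter.eventually_not.2 hne] with i hi
    contrapose! hi
    exact ZFSet.ext fun x => ⟨hi.1 x, hi.2 x⟩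
  rcases Ultrafilter.eventually_or.1 hne' with h1 | h1
  · choose! s hs using fun i (hi : ∃ x ∈ f i, x ∉ g i) => hi
    have hsf : ∀ᶠ i in F, s i ∈ f i := h1.mono fun i hi => (hs i hi).1
    have : collapse hF s ∈ collapse hF g := h ▸ (mem_collapse hF _ _).2 ⟨s, hsf, rfl⟩
    obtain ⟨t, ht, hts⟩ := (mem_collapse hF _ _).1 this
    obtain ⟨i, h1, h2, h3⟩ := (h1.and (ht.and (ih s hsf t hts.symm))).exists
    exact (hs i h1).2 (h3 ▸ h2)
  · choose! s hs using fun i (hi : ∃ x ∈ g i, x ∉ f i) => hi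
    have : collapse hF s ∈ collapse hF f :=
      h ▸ (mem_collapse hF _ _).2 ⟨s, h1.mono fun i hi => (hs i hi).1, rfl⟩
    obtain ⟨t, ht, hts⟩ := (mem_collapse hF _ _).1 this
    obtain ⟨i, h1, h2, h3⟩ := (h1.and (ht.and (ih t ht s hts))).exists
    exact (hs i h1).2 (h3 ▸ h2)

theorem collapse_eq_iff {f g : ι → ZFSet.{u}} :
    collapse hF f = collapse hF g ↔ ∀ᶠ i in F, f i = g i :=
  ⟨eventually_eq_of_collapse_eq hF f g, collapse_congr hF f g⟩

theorem collapse_mem_iff {f g : ι → ZFSet.{u}} :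
    collapse hF f ∈ collapse hF g ↔ ∀ᶠ i in F, f i ∈ g i := by
  rw [mem_collapse]
  refine ⟨fun ⟨s, hs, h⟩ => ?_, fun h => ⟨f, h, rfl⟩⟩
  filter_upwards [hs, (collapse_eq_iff hF).1 h] with i h1 h2
  rwa [← h2]

theorem transClass_range : TransClass (Set.range (collapse hF)) := by
  rintro _ ⟨g, rfl⟩ y hy
  obtain ⟨s, -, rfl⟩ := (mem_collapse hF _ _).1 hy
  exact ⟨s, rfl⟩

/-- The element of the collapsed ultrapower represented by a function. -/
noncomputable def cls (g : ι → ZFSet.{u}) : Set.range (collapse hF) := ⟨collapse hF g, g, rfl⟩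

/-- A set as an element of the universe. -/
def toV (x : ZFSet.{u}) : V.{u} := ⟨x, mem_V x⟩

omit [Small.{u} ι] in
theorem toV_inj {x y : ZFSet.{u}} : toV x = toV y ↔ x = y := Subtype.ext_iff

theorem realize_term {α : Type*} (t : SetLang.Term α) (v : α → ι → ZFSet.{u}) :
    ∃ g : ι → ZFSet.{u}, t.realize (fun k => cls hF (v k)) = cls hF g ∧
      ∀ i, t.realize (fun k => toV (v k i)) = toV (g i) := by
  cases t with
  | var k => exact ⟨v k, rfl, fun _ => rfl⟩
  | func f => exact (f : Empty).elim

theorem sumElim_comp {α β γ δ : Type*} (f : γ → δ) (v : α → γ) (w : β → γ) :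
    Sum.elim (fun k => f (v k)) (fun k => f (w k)) = fun k => f (Sum.elim v w k) := by
  funext k
  cases k <;> rfl

theorem snoc_comp {α β : Type*} {n : ℕ} (f : α → β) (v : Fin n → α) (x : α) :
    (Fin.snoc (fun k => f (v k)) (f x) : Fin (n + 1) → β) =
      fun k => f ((Fin.snoc v x : Fin (n + 1) → α) k) := by
  funext k
  induction k using Fin.lastCases with
  | last => simp only [Fin.snoc_last]
  | cast k => simp only [Fin.snoc_castSucc]

/-- Łoś's theorem. -/
theorem realize_iff {α : Type*} {n : ℕ} (φ : SetLang.BoundedFormula α n) (v : α → ι → ZFSet.{u})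
    (xs : Fin n → ι → ZFSet.{u}) :
    φ.Realize (fun k => cls hF (v k)) (fun k => cls hF (xs k)) ↔
      ∀ᶠ i in F, φ.Realize (fun k => toV (v k i)) (fun k => toV (xs k i)) := by
  have hterm : ∀ {n : ℕ} (t : SetLang.Term (α ⊕ Fin n)) (xs : Fin n → ι → ZFSet.{u}),
      ∃ g : ι → ZFSet.{u},
        t.realize (Sum.elim (fun k => cls hF (v k)) (fun k => cls hF (xs k))) = cls hF g ∧
        ∀ i, t.realize (Sum.elim (fun k => toV (v k i)) (fun k => toV (xs k i))) = toV (g i) := by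
    intro n t xs
    obtain ⟨g, h1, h2⟩ := realize_term hF t (Sum.elim v xs)
    refine ⟨g, ?_, fun i => ?_⟩
    · rw [sumElim_comp, h1]
    · rw [← h2 i]
      congr 1
      funext k
      cases k <;> rfl
  induction φ with
  | falsum =>
    simp only [Language.BoundedFormula.Realize]
    exact (iff_false_intro (Filter.eventually_false_iff_eq_bot.not.2 F.neBot.ne)).symm
  | equal t₁ t₂ =>
    obtain ⟨g₁, h₁, h₁'⟩ := hterm t₁ xs
    obtain ⟨g₂, h₂, h₂'⟩ := hterm t₂ xs
    simp only [Language.BoundedFormula.Realize, h₁, h₁', h₂, h₂', toV_inj]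
    exact Subtype.ext_iff.trans (collapse_eq_iff hF)
  | rel R ts =>
    cases R with
    | mem =>
      obtain ⟨g₁, h₁, h₁'⟩ := hterm (ts 0) xs
      obtain ⟨g₂, h₂, h₂'⟩ := hterm (ts 1) xs
      simp only [Language.BoundedFormula.Realize, Language.Structure.RelMap, h₁, h₁', h₂, h₂']
      exact collapse_mem_iff hF
  | imp φ ψ ih ih' =>
    simp only [Language.BoundedFormula.Realize]
    exact (imp_congr (ih xs) (ih' xs)).trans Ultrafilter.eventually_imp.symm
  | all φ ih =>
    simp only [Language.BoundedFormula.Realize]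
    have hsnoc : ∀ g : ι → ZFSet.{u},
        φ.Realize (fun k => cls hF (v k)) (Fin.snoc (fun k => cls hF (xs k)) (cls hF g)) ↔
        ∀ᶠ i in F, φ.Realize (fun k => toV (v k i))
          (Fin.snoc (fun k => toV (xs k i)) (toV (g i))) := by
      intro g
      have h1 : (Fin.snoc (fun k => cls hF (xs k)) (cls hF g) : Fin _ → Set.range (collapse hF)) =
          fun k => cls hF ((Fin.snoc xs g : Fin _ → ι → ZFSet) k) :=
        snoc_comp (cls hF) xs g
      have h2 : ∀ i, (Fin.snoc (fun k => toV (xs k i)) (toV (g i)) : Fin _ → V) =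
          fun k => toV ((Fin.snoc xs g : Fin _ → ι → ZFSet) k i) := fun i =>
        snoc_comp (fun f : ι → ZFSet => toV (f i)) xs g
      simp only [h1, h2]
      exact ih _
    constructor
    · intro h
      by_contra hne
      have hne' := Ultrafilter.eventually_not.2 hne
      simp only [not_forall] at hne'
      have : Nonempty V.{u} := ⟨toV ∅⟩
      choose! g hg using fun i
        (hi : ∃ x, ¬ φ.Realize (fun k => toV (v k i)) (Fin.snoc (fun k => toV (xs k i)) x)) => hi
      obtain ⟨i, h1, h2⟩ := (hne'.and ((hsnoc fun i => (g i).1).1 (h _))).exists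
      exact hg i h1 h2
    · rintro h ⟨_, g, rfl⟩
      exact (hsnoc g).2 (h.mono fun i hi => hi _)

/-- The ultrapower embedding of the universe. -/
noncomputable def emb : ClassEmb V (Set.range (collapse hF)) where
  j x := collapse hF fun _ => x
  maps x _ := ⟨_, rfl⟩
  elem {n} φ v hv := by
    have h := realize_iff hF φ (fun k _ => v k) (fun _ _ => ∅)
    rw [Filter.eventually_const] at h
    unfold Language.Formula.Realize
    convert h.symm <;> rfl

end Ultrapower

end

section

open Function Filter

namespace Ultrapower

variable {ι : Type (u + 1)} [Small.{u} ι] {F : Ultrafilter ι} (hF : SigmaComplete F)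

theorem collapse_pair_set (f g : ι → ZFSet.{u}) :
    collapse hF (fun i => {f i, g i}) = {collapse hF f, collapse hF g} := by
  ext x
  rw [mem_collapse, ZFSet.mem_pair]
  constructor
  · rintro ⟨s, hs, rfl⟩
    simp only [ZFSet.mem_pair] at hs
    simp only [collapse_eq_iff]
    exact Ultrafilter.eventually_or.1 hs
  · rintro (rfl | rfl)
    · exact ⟨f, by simp, rfl⟩
    · exact ⟨g, by simp, rfl⟩

theorem collapse_pair (f g : ι → ZFSet.{u}) :
    collapse hF (fun i => ZFSet.pair (f i) (g i)) =
      ZFSet.pair (collapse hF f) (collapse hF g) := by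
  have h : ∀ x y : ZFSet.{u}, ZFSet.pair x y = {{x, x}, {x, y}} := fun x y => by
    simp [ZFSet.pair]
  simp only [h, collapse_pair_set]

end Ultrapower

namespace IsCode

variable {κ ℓ T A I U : ZFSet.{u}}

/-- The ultrafilter of a code, as an ultrafilter on the index set. -/
def ultrafilter (h : IsCode V κ ℓ T A I U) : Ultrafilter I :=
  .ofComplNotMemIff
    { sets := {S | ∃ X ∈ U, ∀ e : I, e.1 ∈ X → e ∈ S}
      univ_sets := by
        have := h.ultra I (mem_V _) (fun _ => id) I (mem_V _) (fun _ => id) (fun _ => .inl)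
        exact ⟨I, this.elim id id, fun _ _ => Set.mem_univ _⟩
      sets_of_superset := fun ⟨X, hX, hS⟩ hST => ⟨X, hX, fun e he => hST (hS e he)⟩
      inter_sets := fun ⟨X, hX, hS⟩ ⟨Y, hY, hT⟩ => by
        refine ⟨X ∩ Y, h.inter X hX Y hY _ (mem_V _) (fun e he => ?_) (fun e h1 h2 => ?_),
          fun e he => ?_⟩
        · exact h.usub X hX e (ZFSet.mem_inter.1 he).1
        · exact ZFSet.mem_inter.2 ⟨h1, h2⟩
        · exact ⟨hS e (ZFSet.mem_inter.1 he).1, hT e (ZFSet.mem_inter.1 he).2⟩ }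
    fun S => by
      constructor
      · intro hS
        have hcov : ∀ e ∈ I, e ∈ ZFSet.sep (fun e => ∃ he : e ∈ I, ⟨e, he⟩ ∈ S) I ∨
            e ∈ ZFSet.sep (fun e => ∃ he : e ∈ I, ⟨e, he⟩ ∉ S) I := fun e he => by
          simp only [ZFSet.mem_sep]
          by_cases hS : (⟨e, he⟩ : I) ∈ S
          · exact .inl ⟨he, he, hS⟩
          · exact .inr ⟨he, he, hS⟩
        rcases h.ultra _ (mem_V _) (fun e he => (ZFSet.mem_sep.1 he).1) _ (mem_V _)
          (fun e he => (ZFSet.mem_sep.1 he).1) hcov with hU | hU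
        · exact ⟨_, hU, fun e he => (ZFSet.mem_sep.1 he).2.2⟩
        · exact (hS ⟨_, hU, fun e he => (ZFSet.mem_sep.1 he).2.2⟩).elim
      · rintro ⟨X, hX, hS⟩ ⟨Y, hY, hS'⟩
        obtain ⟨e, he, heI⟩ := h.nonempty (X ∩ Y) (h.inter X hX Y hY _ (mem_V _)
          (fun e he => h.usub X hX e (ZFSet.mem_inter.1 he).1)
          (fun e h1 h2 => ZFSet.mem_inter.2 ⟨h1, h2⟩))
        rw [ZFSet.mem_inter] at he
        exact hS' ⟨e, heI⟩ he.2 (hS ⟨e, heI⟩ he.1)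

variable (h : IsCode V κ ℓ T A I U)
include h

theorem eventually_normal (R : I → ZFSet.{u} → Prop)
    (hR : ∀ᶠ e : I in h.ultrafilter, ∃ a ∈ T, (∃ b, ZFSet.pair b a ∈ e.1) ∧ R e a) :
    ∃ a ∈ T, ∀ᶠ e in h.ultrafilter, R e a := by
  obtain ⟨X, hX, hR⟩ : ∃ X ∈ U, ∀ e : I, e.1 ∈ X →
    ∃ a ∈ T, (∃ b, ZFSet.pair b a ∈ e.1) ∧ R e a := hR
  obtain ⟨a, ha, Y, hY, haY⟩ := h.normal
    (ZFSet.sep (fun p => ∃ (e : I) (a : ZFSet), p = ZFSet.pair e.1 a ∧ R e a) (ZFSet.prod I T))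
    (mem_V _) X hX (fun e he => by
      have heI := h.usub X hX e he
      obtain ⟨a, ha, hb, hr⟩ := hR ⟨e, heI⟩ he
      exact ⟨a, ha, hb, by
        rw [ZFSet.mem_sep, ZFSet.pair_mem_prod]
        exact ⟨⟨heI, ha⟩, ⟨e, heI⟩, a, rfl, hr⟩⟩)
  refine ⟨a, ha, Y, hY, fun e he => ?_⟩
  obtain ⟨-, e', a', heq, hr⟩ := ZFSet.mem_sep.1 (haY e.1 he)
  obtain ⟨h1, h2⟩ := ZFSet.pair_inj.1 heq
  rw [Subtype.ext h1, h2]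
  exact hr

theorem eventually_iso : ∀ᶠ e : I in h.ultrafilter, ∀ a ∈ T, ∀ b, ZFSet.pair b a ∈ e.1 →
    (∀ b' ∈ b, ∃ a' ∈ T, ZFSet.pair b' a' ∈ e.1) ∧
    ∀ a' ∈ T, ∀ b', ZFSet.pair b' a' ∈ e.1 → (b' ∈ b ↔ a' ∈ a) ∧ (b' = b ↔ a' = a) := by
  obtain ⟨X, hX, hX'⟩ := h.iso
  exact ⟨X, hX, fun e he => hX' e he⟩

theorem eventually_fine {a : ZFSet.{u}} (ha : a ∈ T) :
    ∀ᶠ e : I in h.ultrafilter, ∃ b, ZFSet.pair b a ∈ e.1 := by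
  obtain ⟨X, hX, hX'⟩ := h.fine a ha
  exact ⟨X, hX, fun e he => hX' e he⟩

theorem eventually_guess : ∀ᶠ e : I in h.ultrafilter, ∃ δ ∈ κ, ZFSet.pair δ κ ∈ e.1 ∧
    (∃ B, ZFSet.pair B A ∈ e.1 ∧ ZFSet.pair δ B ∈ ℓ) ∧ ∀ α ∈ δ, ZFSet.pair α α ∈ e.1 := by
  obtain ⟨X, hX, hX'⟩ := h.guess
  exact ⟨X, hX, fun e he => hX' e he⟩

theorem eventually_bound {a : ZFSet.{u}} (ha : a ∈ T) (ho : a.IsOrdinal) :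
    ∀ᶠ e : I in h.ultrafilter, ∃ δ ∈ κ, ZFSet.pair δ a ∈ e.1 := by
  obtain ⟨X, hX, hX'⟩ := h.bound a ha ho
  exact ⟨X, hX, fun e he => hX' e he⟩

theorem eventually_self (hT : T.IsTransitive) (hκ : κ.IsOrdinal) (hκT : κ ∈ T) {α : ZFSet.{u}}
    (hα : α ∈ κ) : ∀ᶠ e : I in h.ultrafilter, ∃ δ ∈ κ, α ∈ δ ∧ ∀ β ∈ δ, ZFSet.pair β β ∈ e.1 := by
  have hαT := hT.mem_trans hα hκT
  filter_upwards [h.eventually_iso, h.eventually_guess, h.eventually_bound hαT (hκ.mem hα)]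
    with e hiso ⟨δ, hδ, hδκ, _, hid⟩ ⟨δ', hδ', hδα⟩
  have hmem : δ' ∈ δ := ((hiso κ hκT δ hδκ).2 α hαT δ' hδα).1.2 hα
  have hT' : δ' ∈ T := hT.mem_trans hδ' hκT
  have : δ' = α := ((hiso α hαT δ' hδα).2 δ' hT' δ' (hid δ' hmem)).2.1 rfl
  exact ⟨δ, hδ, this ▸ hmem, hid⟩

theorem sigmaComplete (hT : T.IsTransitive) (hκ : κ.IsOrdinal) (hκT : κ ∈ T)
    (hω : Ordinal.omega0.toZFSet ∈ κ) : Ultrapower.SigmaComplete h.ultrafilter := by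
  intro P hP
  by_contra! hne
  obtain ⟨a, -, ha⟩ := h.eventually_normal
    (fun e a => ∃ n : ℕ, a = (n : Ordinal).toZFSet ∧ ¬ P n e) (by
      filter_upwards [h.eventually_self hT hκ hκT hω] with e ⟨δ, hδ, hωδ, hid⟩
      obtain ⟨n, hn⟩ := hne e
      have hnδ : (n : Ordinal).toZFSet ∈ δ := (hκ.mem hδ).mem_trans
        (Ordinal.toZFSet_mem_toZFSet_iff.2 (Ordinal.natCast_lt_omega0 n)) hωδ
      exact ⟨_, hT.mem_trans (hκ.mem_trans hnδ hδ) hκT, ⟨_, hid _ hnδ⟩, n, rfl, hn⟩)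
  obtain ⟨e, n, rfl, -⟩ := ha.exists
  obtain ⟨e, ⟨m, hm, hPm⟩, hPn⟩ := (ha.and (hP n)).exists
  have : n = m := by exact_mod_cast Ordinal.toZFSet_injective hm
  exact hPm (this ▸ hPn)

omit h in
/-- The collapse of `a` along `e`. -/
noncomputable def coll (a : ZFSet.{u}) (e : I) : ZFSet.{u} :=
  Classical.epsilon fun b => ZFSet.pair b a ∈ e.1

theorem eventually_coll {a : ZFSet.{u}} (ha : a ∈ T) :
    ∀ᶠ e : I in h.ultrafilter, ZFSet.pair (coll a e) a ∈ e.1 :=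
  (h.eventually_fine ha).mono fun _ he => Classical.epsilon_spec he

theorem eventually_coll_eq {a : ZFSet.{u}} (ha : a ∈ T) :
    ∀ᶠ e : I in h.ultrafilter, ∀ b, ZFSet.pair b a ∈ e.1 → coll a e = b := by
  filter_upwards [h.eventually_coll ha, h.eventually_iso] with e h1 h2 b hb
  exact ((h2 a ha b hb).2 a ha _ h1).2.2 rfl

variable (hσ : Ultrapower.SigmaComplete h.ultrafilter) (hT : T.IsTransitive)
include hT

open Ultrapower

theorem collapse_coll {a : ZFSet.{u}} (ha : a ∈ T) : collapse hσ (coll a) = a := by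
  induction a using ZFSet.inductionOn with
  | _ a ih =>
  ext x
  rw [mem_collapse]
  constructor
  · rintro ⟨s, hs, rfl⟩
    obtain ⟨a', ha', hs'⟩ := h.eventually_normal (fun e a' => ZFSet.pair (s e) a' ∈ e.1 ∧ a' ∈ a)
      (by
        filter_upwards [h.eventually_coll ha, h.eventually_iso, hs] with e h1 h2 h3
        obtain ⟨a', ha', hp⟩ := (h2 a ha _ h1).1 _ h3
        exact ⟨a', ha', ⟨_, hp⟩, hp, ((h2 a ha _ h1).2 a' ha' _ hp).1.1 h3⟩)
    obtain ⟨e, -, ha'a⟩ := hs'.exists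
    have : collapse hσ s = a' := by
      rw [← ih a' ha'a ha', collapse_eq_iff]
      filter_upwards [hs', h.eventually_coll_eq ha'] with e h1 h2
      exact (h2 _ h1.1).symm
    exact this ▸ ha'a
  · intro hx
    have hxT := hT.mem_trans hx ha
    refine ⟨coll x, ?_, ih x hx hxT⟩
    filter_upwards [h.eventually_coll ha, h.eventually_coll hxT, h.eventually_iso] with e h1 h2 h3
    exact ((h3 a ha _ h1).2 x hxT _ h2).1.2 hx

theorem seqClosed {θ : ZFSet.{u}} (hθT : θ ∈ T) : SeqClosed θ (Set.range (collapse hσ)) := by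
  intro f ⟨hf, hf'⟩
  have hval : ∀ a ∈ θ, ∃ g : I → ZFSet.{u}, ZFSet.pair a (collapse hσ g) ∈ f := by
    intro a ha
    obtain ⟨b, hb, -⟩ := hf' a ha
    obtain ⟨a', b', -, ⟨g, rfl⟩, heq⟩ := hf _ hb
    exact ⟨g, (ZFSet.pair_inj.1 heq).2 ▸ hb⟩
  choose! g hg using hval
  have hsmall : ∀ e : I, Small.{u} {a : θ // ∃ b, ZFSet.pair b a.1 ∈ e.1} := fun e => inferInstance
  let H : I → ZFSet.{u} := fun e => ZFSet.range
    fun a : {a : θ // ∃ b, ZFSet.pair b a.1 ∈ e.1} => ZFSet.pair (coll a.1.1 e) (g a.1.1 e)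
  refine ⟨H, ZFSet.ext fun x => ?_⟩
  have hcoll : ∀ a ∈ θ, collapse hσ (fun e => ZFSet.pair (coll a e) (g a e)) =
      ZFSet.pair a (collapse hσ (g a)) := fun a ha => by
    rw [collapse_pair, h.collapse_coll hσ hT (hT.mem_trans ha hθT)]
  rw [mem_collapse]
  constructor
  · rintro ⟨s, hs, rfl⟩
    obtain ⟨a, haT, ha⟩ := h.eventually_normal
      (fun e a => a ∈ θ ∧ s e = ZFSet.pair (coll a e) (g a e)) (by
        filter_upwards [hs] with e he
        obtain ⟨⟨a, hb⟩, ha⟩ := ZFSet.mem_range.1 he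
        exact ⟨a, hT.mem_trans a.2 hθT, hb, a.2, ha.symm⟩)
    obtain ⟨e, haθ, -⟩ := ha.exists
    rw [(collapse_eq_iff hσ).2 (ha.mono fun e he => he.2), hcoll a haθ]
    exact hg a haθ
  · intro hx
    obtain ⟨a, b, ha, -, rfl⟩ := hf x hx
    refine ⟨fun e => ZFSet.pair (coll a e) (g a e), ?_, ?_⟩
    · filter_upwards [h.eventually_fine (hT.mem_trans ha hθT)] with e he
      exact ZFSet.mem_range.2 ⟨⟨⟨a, ha⟩, he⟩, rfl⟩
    · rw [hcoll a ha, (hf' a ha).unique (hg a ha) hx]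

omit hT in
/-- A code in the universe yields a supercompactness embedding. -/
theorem exists_emb {θ : ZFSet.{u}} (hT : T.IsTransitive) (hκ : κ.IsOrdinal) (hκT : κ ∈ T)
    (hω : Ordinal.omega0.toZFSet ∈ κ) (hAT : A ∈ T) (hθT : θ ∈ T) (hθ : θ.IsOrdinal) :
    ∃ E : SCEmb κ θ, ZFSet.pair κ A ∈ E.e.j ℓ := by
  have hσ := h.sigmaComplete hT hκ hκT hω
  have hbound : ∀ a ∈ T, a.IsOrdinal → a ∈ collapse hσ (fun _ => κ) := by
    intro a ha ho
    nth_rw 1 [← h.collapse_coll hσ hT ha]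
    rw [collapse_mem_iff]
    filter_upwards [h.eventually_bound ha ho, h.eventually_coll_eq ha] with e ⟨δ, hδ, hp⟩ h2
    exact h2 δ hp ▸ hδ
  refine ⟨⟨_, transClass_range hσ, emb hσ, ⟨hκ, hbound κ hκT hκ, fun α _ hα => ?_⟩,
    h.seqClosed hσ hT hθT, hbound θ hθT hθ⟩, ?_⟩
  · have hαT := hT.mem_trans hα hκT
    nth_rw 2 [← h.collapse_coll hσ hT hαT]
    refine ((collapse_eq_iff hσ).2 ?_).symm
    filter_upwards [h.eventually_self hT hκ hκT hα, h.eventually_coll_eq hαT]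
      with e ⟨δ, _, h1, h2⟩ h3
    exact h3 α (h2 α h1)
  · change ZFSet.pair κ A ∈ collapse hσ fun _ => ℓ
    have : ZFSet.pair κ A = collapse hσ fun e => ZFSet.pair (coll κ e) (coll A e) := by
      rw [collapse_pair, h.collapse_coll hσ hT hκT, h.collapse_coll hσ hT hAT]
    rw [this, collapse_mem_iff]
    filter_upwards [h.eventually_guess, h.eventually_coll_eq hκT, h.eventually_coll_eq hAT]
      with e ⟨δ, _, h1, ⟨B, h2, h3⟩, _⟩ h4 h5
    rw [h4 _ h1, h5 _ h2]
    exact h3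

end IsCode

end

section

open Function Fml
open scoped ZFSet

/-! ### Consequences of elementarity -/

/-- The assignment listing the given sets. -/
def asg (l : List ZFSet.{u}) (i : ℕ) : ZFSet.{u} := l.getD i ∅

@[simp] theorem asg_cons_zero (x : ZFSet.{u}) (l : List ZFSet.{u}) : asg (x :: l) 0 = x := rfl

@[simp] theorem asg_cons_succ (x : ZFSet.{u}) (l : List ZFSet.{u}) (i : ℕ) :
    asg (x :: l) (i + 1) = asg l i := rfl

namespace ClassEmb

variable {M : Set ZFSet.{u}} (e : ClassEmb V M) (hM : TransClass M)
include e hM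

theorem transfer (φ : Fml) (hφ : φ.good) (l : List ZFSet.{u}) (h : φ.Sat V (asg l)) :
    φ.Sat M fun i => e.j (asg l i) :=
  (e.sat_iff hM φ hφ _).1 h

theorem mem_iff {x y : ZFSet.{u}} : e.j x ∈ e.j y ↔ x ∈ y :=
  (e.sat_iff hM (.mem 0 1) rfl (asg [x, y])).symm

theorem eq_iff {x y : ZFSet.{u}} : e.j x = e.j y ↔ x = y :=
  (e.sat_iff hM (.eq 0 1) rfl (asg [x, y])).symm

theorem isOrdinal {x : ZFSet.{u}} (hx : x.IsOrdinal) : (e.j x).IsOrdinal :=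
  (e.sat_iff hM (.ord 0) rfl (asg [x])).1 hx

theorem map_pair (x y : ZFSet.{u}) : e.j (ZFSet.pair x y) = ZFSet.pair (e.j x) (e.j y) :=
  e.transfer hM (.eqPair 0 1 2) rfl [ZFSet.pair x y, x, y] rfl

theorem pair_mem_iff {x y z : ZFSet.{u}} :
    ZFSet.pair (e.j x) (e.j y) ∈ e.j z ↔ ZFSet.pair x y ∈ z := by
  rw [← e.map_pair hM, e.mem_iff hM]

theorem map_subset {x y : ZFSet.{u}} (h : x ⊆ y) : e.j x ⊆ e.j y := fun z hz => by
  have := e.transfer hM (ball 2 0 (.mem 2 1)) rfl [x, y] (by simpa using fun z hz => h hz)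
  simpa using this z hz

theorem map_empty : e.j ∅ = ∅ := by
  have := e.transfer hM (ball 2 0 (neg (.eq 2 2))) rfl [∅] (by simp)
  simpa [ZFSet.eq_empty] using this

theorem empty_mem : ∅ ∈ M := e.map_empty hM ▸ e.maps ∅ (mem_V _)

theorem pair_mem {x y : ZFSet.{u}} (hx : x ∈ M) (hy : y ∈ M) : ZFSet.pair x y ∈ M := by
  have := e.transfer hM (.all 0 (.all 1 (.ex 2 (.eqPair 2 0 1)))) rfl [] (by simp)
  simp only [sat_all, sat_ex, sat_eqPair] at this
  obtain ⟨p, hp, h⟩ := this x hx y hy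
  simp at h
  exact h ▸ hp

theorem exists_range {f : ZFSet.{u}} (hf : f ∈ M) :
    ∃ r ∈ M, ∀ y ∈ M, y ∈ r ↔ ∃ a, ZFSet.pair a y ∈ f := by
  have := e.transfer hM (.all 0 (.ex 1 (.all 2 (.iff (.mem 2 1) (.exFst 3 2 0 (.eq 3 3)))))) rfl []
    (by
      simp only [sat_all, sat_ex, Fml.sat_iff, sat_mem, sat_exFst, sat_eq]
      intro f _
      refine ⟨ZFSet.sep (fun y => ∃ a, ZFSet.pair a y ∈ f) (⋃₀ (⋃₀ f : ZFSet) : ZFSet), mem_V _,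
        fun y _ => ?_⟩
      simp
      intro a ha
      exact ⟨{a, y}, ⟨_, ha, by simp [ZFSet.pair]⟩, by simp⟩)
  simp only [sat_all, sat_ex, Fml.sat_iff, sat_mem, sat_exFst, sat_eq] at this
  obtain ⟨r, hr, h⟩ := this f hf
  refine ⟨r, hr, fun y hy => ?_⟩
  simpa using h y hy

end ClassEmb

namespace SCEmb

variable {κ θ : ZFSet.{u}} (E : SCEmb κ θ)

theorem mem_of_card_le {x : ZFSet.{u}} (hx : ∀ y ∈ x, y ∈ E.M)
    (hc : Cardinal.mk x.toSet ≤ Cardinal.mk θ.toSet) : x ∈ E.M := by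
  rcases x.eq_empty_or_nonempty with rfl | hne
  · exact E.e.empty_mem E.trans
  have : Nonempty x.toSet := hne.to_subtype
  obtain ⟨⟨i, hi⟩⟩ := Cardinal.le_def _ _ |>.1 hc
  let g := invFun i
  have hg : Surjective g := invFun_surjective hi
  let f : ZFSet.{u} := ZFSet.range fun a : ↥θ => ZFSet.pair a.1 (g a).1
  have hf : ∀ a y, ZFSet.pair a y ∈ f ↔ ∃ ha : a ∈ θ, (g ⟨a, ha⟩).1 = y := by
    intro a y
    simp only [f, ZFSet.mem_range, ZFSet.pair_inj]
    constructor
    · rintro ⟨⟨b, hb⟩, rfl, rfl⟩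
      exact ⟨hb, rfl⟩
    · rintro ⟨ha, rfl⟩
      exact ⟨⟨a, ha⟩, rfl, rfl⟩
  have hfM : f ∈ E.M := by
    refine E.closed f ⟨fun p hp => ?_, fun a ha => ?_⟩
    · obtain ⟨a, rfl⟩ := ZFSet.mem_range.1 hp
      exact ⟨a.1, _, a.2, hx _ (g a).2, rfl⟩
    · exact ⟨(g ⟨a, ha⟩).1, (hf _ _).2 ⟨ha, rfl⟩, fun y hy => ((hf _ _).1 hy).2.symm⟩
  obtain ⟨r, hr, h⟩ := E.e.exists_range E.trans hfM
  suffices x = r from this ▸ hr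
  ext y
  constructor
  · intro hy
    obtain ⟨a, ha⟩ := hg ⟨y, hy⟩
    exact (h y (hx y hy)).2 ⟨a.1, (hf _ _).2 ⟨a.2, by simp [ha]⟩⟩
  · intro hy
    obtain ⟨a, ha⟩ := (h y (E.trans r hr y hy)).1 hy
    obtain ⟨ha, rfl⟩ := (hf _ _).1 ha
    exact (g _).2

theorem mk_mono {x y : ZFSet.{u}} (h : x ⊆ y) : Cardinal.mk x.toSet ≤ Cardinal.mk y.toSet :=
  Cardinal.mk_le_mk_of_subset h

theorem mem_of_mem_vonNeumann {β : Ordinal.{u}}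
    (hβ : Cardinal.mk (V_ β).toSet ≤ Cardinal.mk θ.toSet) {x : ZFSet.{u}} (hx : x ∈ V_ β) :
    x ∈ E.M := by
  induction x using ZFSet.inductionOn with
  | _ x ih =>
  have hsub := (ZFSet.isTransitive_vonNeumann β).subset_of_mem hx
  exact E.mem_of_card_le (fun y hy => ih y hy (hsub hy)) ((mk_mono hsub).trans hβ)

theorem map_of_mem {α : ZFSet.{u}} (hα : α ∈ κ) : E.e.j α = α :=
  E.crit.2.2 α (E.crit.1.mem hα) hα

include E in
theorem omega_mem : Ordinal.omega0.toZFSet ∈ κ := by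
  have hκ := E.crit.1
  by_contra hω
  have hle : κ.rank ≤ Ordinal.omega0 := by
    rw [← (ZFSet.isOrdinal_toZFSet _).rank_lt_iff_mem hκ, Ordinal.rank_toZFSet, not_lt] at hω
    exact hω
  have := E.e.transfer E.trans (.ball 1 0 (.or (.ball 2 1 (.neg (.eq 2 2)))
    (.bex 3 1 (.ball 2 1 (.or (.mem 2 3) (.eq 2 3)))))) rfl [κ] (by
      simp only [sat_ball, sat_or, sat_bex, sat_mem, sat_eq, sat_neg]
      simp
      intro x hx
      have hxo := hκ.mem hx
      obtain ⟨n, hn⟩ := Ordinal.lt_omega0.1 ((ZFSet.rank_lt_of_mem hx).trans_le hle)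
      rw [← hxo.toZFSet_rank_eq, hn]
      cases n with
      | zero => left; simp
      | succ n =>
        right
        refine ⟨(n : Ordinal).toZFSet, Ordinal.toZFSet_mem_toZFSet_iff.2 (by simp), ?_⟩
        intro z hz
        obtain ⟨a, ha, rfl⟩ := Ordinal.mem_toZFSet_iff.1 hz
        rw [Ordinal.toZFSet_mem_toZFSet_iff, Ordinal.toZFSet_injective.eq_iff]
        push_cast at ha
        exact (Order.lt_add_one_iff.1 ha).lt_or_eq)
  simp only [sat_ball, sat_or, sat_bex, sat_mem, sat_eq, sat_neg] at this
  rcases this κ (by simpa using E.crit.2.1) with h | ⟨y, hy, h⟩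
  · simp at h
    have : κ = ∅ := (ZFSet.eq_empty κ).2 h
    subst this
    have := E.crit.2.1
    rw [E.e.map_empty E.trans] at this
    exact ZFSet.notMem_empty _ this
  · simp at h hy
    have h2 := E.e.transfer E.trans (.ball 2 0 (.or (.mem 2 1) (.eq 2 1))) rfl [κ, y]
      (by simpa using h)
    have h3 : κ ∈ y ∨ κ = y := by
      simpa [E.map_of_mem hy] using h2 κ (by simpa using E.crit.2.1)
    rcases h3 with h3 | rfl
    · exact ZFSet.mem_asymm hy h3
    · exact ZFSet.mem_irrefl _ hy

end SCEmb

end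

section

open Function Fml
open scoped ZFSet

/-- The cumulative hierarchy below `κ`, as a set of pairs. -/
noncomputable def hier (κ : ZFSet.{u}) : ZFSet.{u} :=
  ZFSet.range fun α : ↥κ => ZFSet.pair α.1 (V_ α.1.rank)

theorem pair_mem_hier {κ α v : ZFSet.{u}} :
    ZFSet.pair α v ∈ hier κ ↔ α ∈ κ ∧ v = V_ α.rank := by
  simp only [hier, ZFSet.mem_range, ZFSet.pair_inj]
  constructor
  · rintro ⟨⟨b, hb⟩, rfl, rfl⟩
    exact ⟨hb, rfl⟩
  · rintro ⟨ha, rfl⟩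
    exact ⟨⟨α, ha⟩, rfl, rfl⟩

namespace SCEmb

variable {κ θ : ZFSet.{u}} (E : SCEmb κ θ)

theorem exists_pair_mem_hier {α : ZFSet.{u}} (hα : α ∈ E.e.j κ) :
    ∃ v, ZFSet.pair α v ∈ E.e.j (hier κ) := by
  have := E.e.transfer E.trans (.ball 0 1 (.ex 2 (.pairMem 0 2 3))) rfl [∅, κ, ∅, hier κ]
    (by simp [pair_mem_hier])
  simp at this
  obtain ⟨v, -, hv⟩ := this α hα
  exact ⟨v, hv⟩

theorem mem_iff_of_pair_mem_hier {α v : ZFSet.{u}} (hα : α ∈ E.e.j κ)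
    (hv : ZFSet.pair α v ∈ E.e.j (hier κ)) {y : ZFSet.{u}} (hy : y ∈ E.M) :
    y ∈ v ↔ ∃ γ ∈ α, ∃ w, ZFSet.pair γ w ∈ E.e.j (hier κ) ∧ y ⊆ w := by
  have := E.e.transfer E.trans (.ball 0 1 (.all 2 (.imp (.pairMem 0 2 3) (.all 4 (.iff (.mem 4 2)
    (.bex 5 0 (.ex 6 (.and (.pairMem 5 6 3) (.ball 7 4 (.mem 7 6)))))))))) rfl
    [∅, κ, ∅, hier κ] (by
      simp [pair_mem_hier]
      intro α hα y
      have hαo := E.crit.1.mem hα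
      rw [ZFSet.mem_vonNeumann']
      constructor
      · rintro ⟨a, ha, hy⟩
        have : a.toZFSet ∈ α := by
          rwa [← (ZFSet.isOrdinal_toZFSet a).rank_lt_iff_mem hαo, Ordinal.rank_toZFSet]
        exact ⟨_, this, E.crit.1.mem_trans this hα, by simpa using fun x hx => hy hx⟩
      · rintro ⟨γ, hγ, _, h⟩
        exact ⟨_, ZFSet.rank_lt_of_mem hγ, h⟩)
  simp at this
  have hvM := (E.trans.of_pair (E.trans _ (E.e.maps (hier κ) (mem_V _)) _ hv)).2
  rw [this α hα v hvM hv y hy]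
  constructor
  · rintro ⟨γ, hγ, w, -, h1, h2⟩
    exact ⟨γ, hγ, w, h1, h2⟩
  · rintro ⟨γ, hγ, w, h1, h2⟩
    exact ⟨γ, hγ, w, (E.trans.of_pair (E.trans _ (E.e.maps (hier κ) (mem_V _)) _ h1)).2, h1, h2⟩

theorem subset_map_vonNeumann {α v : ZFSet.{u}} (hα : α ∈ E.e.j κ)
    (hv : ZFSet.pair α v ∈ E.e.j (hier κ)) : v ⊆ E.e.j (V_ κ.rank) := by
  have := E.e.transfer E.trans (.ball 0 1 (.all 2 (.imp (.pairMem 0 2 3) (.ball 4 2 (.mem 4 5)))))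
    rfl [∅, κ, ∅, hier κ, ∅, V_ κ.rank] (by
      simp [pair_mem_hier]
      intro α hα x hx
      rw [ZFSet.mem_vonNeumann] at hx ⊢
      exact hx.trans (ZFSet.rank_lt_of_mem hα))
  simp at this
  intro x hx
  exact this α hα v (E.trans.of_pair (E.trans _ (E.e.maps (hier κ) (mem_V _)) _ hv)).2 hv x hx

theorem map_pfun_functional {ℓ : ZFSet.{u}} (hℓ : IsPFun κ ℓ) {a b c : ZFSet.{u}}
    (hb : ZFSet.pair a b ∈ E.e.j ℓ) (hc : ZFSet.pair a c ∈ E.e.j ℓ) : b = c := by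
  have := E.e.transfer E.trans (.all 0 (.all 1 (.all 2 (.imp (.pairMem 0 1 3)
    (.imp (.pairMem 0 2 3) (.eq 1 2)))))) rfl [∅, ∅, ∅, ℓ] (by
      simp
      exact hℓ.2)
  simp at this
  have hM := E.trans _ (E.e.maps ℓ (mem_V _))
  exact this a (E.trans.of_pair (hM _ hb)).1 b (E.trans.of_pair (hM _ hb)).2 c
    (E.trans.of_pair (hM _ hc)).2 hb hc

variable {β : Ordinal.{u}} (hβ : Cardinal.mk (V_ β).toSet ≤ Cardinal.mk θ.toSet)
include hβ

theorem eq_vonNeumann_of_pair_mem_hier {α v : ZFSet.{u}} (hα : α ∈ E.e.j κ) (hαβ : α.rank ≤ β)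
    (hv : ZFSet.pair α v ∈ E.e.j (hier κ)) : v = V_ α.rank := by
  have hjκ := E.e.isOrdinal E.trans E.crit.1
  induction α using ZFSet.inductionOn generalizing v with
  | _ α ih =>
  have ih' : ∀ γ ∈ α, ∀ w, ZFSet.pair γ w ∈ E.e.j (hier κ) → w = V_ γ.rank := fun γ hγ w hw =>
    ih γ hγ (hjκ.mem_trans hγ hα) ((ZFSet.rank_lt_of_mem hγ).le.trans hαβ) hw
  have hvM := (E.trans.of_pair (E.trans _ (E.e.maps (hier κ) (mem_V _)) _ hv)).2
  ext y
  constructor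
  · intro hy
    obtain ⟨γ, hγ, w, hw, hyw⟩ := (E.mem_iff_of_pair_mem_hier hα hv (E.trans v hvM y hy)).1 hy
    rw [ih' γ hγ w hw] at hyw
    exact ZFSet.mem_vonNeumann'.2 ⟨_, ZFSet.rank_lt_of_mem hγ, hyw⟩
  · intro hy
    have hyM := E.mem_of_mem_vonNeumann hβ (ZFSet.vonNeumann_subset_of_le hαβ hy)
    obtain ⟨a, ha, hya⟩ := ZFSet.mem_vonNeumann'.1 hy
    have haα : a.toZFSet ∈ α := by
      rwa [← (ZFSet.isOrdinal_toZFSet a).rank_lt_iff_mem (hjκ.mem hα), Ordinal.rank_toZFSet]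
    obtain ⟨w, hw⟩ := E.exists_pair_mem_hier (hjκ.mem_trans haα hα)
    refine (E.mem_iff_of_pair_mem_hier hα hv hyM).2 ⟨_, haα, w, hw, ?_⟩
    rwa [ih' _ haα w hw, Ordinal.rank_toZFSet]

variable (hκβ : κ.rank ≤ β)
include hκβ

theorem map_vonNeumann {α : ZFSet.{u}} (hα : α ∈ κ) : E.e.j (V_ α.rank) = V_ α.rank := by
  have h1 : ZFSet.pair α (E.e.j (V_ α.rank)) ∈ E.e.j (hier κ) := by
    have := (E.e.pair_mem_iff E.trans).2 (pair_mem_hier.2 ⟨hα, rfl⟩)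
    rwa [E.map_of_mem hα] at this
  refine E.eq_vonNeumann_of_pair_mem_hier hβ ?_ ((ZFSet.rank_lt_of_mem hα).le.trans hκβ) h1
  rw [← E.map_of_mem hα]
  exact (E.e.mem_iff E.trans).2 hα

theorem map_eq_self {x : ZFSet.{u}} (hx : MemV κ x) : E.e.j x = x := by
  induction hr : x.rank using WellFoundedLT.induction generalizing x with
  | _ a ih =>
  subst hr
  unfold MemV at hx
  have hα : x.rank.toZFSet ∈ κ := by
    rwa [← (ZFSet.isOrdinal_toZFSet _).rank_lt_iff_mem E.crit.1, Ordinal.rank_toZFSet]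
  have hv := E.map_vonNeumann hβ hκβ hα
  rw [Ordinal.rank_toZFSet] at hv
  have hsub := E.e.map_subset E.trans (ZFSet.subset_vonNeumann_self x)
  rw [hv] at hsub
  ext y
  constructor
  · intro hy
    rw [← E.e.mem_iff E.trans]
    have hy' := ZFSet.mem_vonNeumann.1 (hsub hy)
    rwa [ih _ hy' (hy'.trans hx) rfl]
  · intro hy
    have hy' := ZFSet.rank_lt_of_mem hy
    rw [← ih _ hy' (hy'.trans hx) rfl]
    exact (E.e.mem_iff E.trans).2 hy

theorem pair_mem_map_pfun {ℓ δ B : ZFSet.{u}} (hℓ : IsPFun κ ℓ) (hδ : δ ∈ κ) :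
    ZFSet.pair δ B ∈ E.e.j ℓ ↔ ZFSet.pair δ B ∈ ℓ := by
  have key : ∀ B, ZFSet.pair δ B ∈ ℓ → ZFSet.pair δ B ∈ E.e.j ℓ := by
    intro B hB
    obtain ⟨γ, A, -, hA, h⟩ := hℓ.1 _ hB
    obtain ⟨rfl, rfl⟩ := ZFSet.pair_inj.1 h
    have := (E.e.pair_mem_iff E.trans).2 hB
    rwa [E.map_of_mem hδ, E.map_eq_self hβ hκβ hA] at this
  refine ⟨fun h => ?_, key B⟩
  by_cases hB : ∃ B', ZFSet.pair δ B' ∈ ℓ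
  · obtain ⟨B', hB'⟩ := hB
    rwa [E.map_pfun_functional hℓ h (key B' hB')]
  · have := E.e.transfer E.trans (.all 1 (.neg (.pairMem 0 1 2))) rfl [δ, ∅, ℓ] (by simpa using hB)
    simp [E.map_of_mem hδ] at this
    exact (this B (E.trans.of_pair (E.trans _ (E.e.maps ℓ (mem_V _)) _ h)).2 h).elim

end SCEmb

end

section

open Function Fml
open scoped ZFSet

theorem update_asg_zero (x y : ZFSet.{u}) (l : List ZFSet.{u}) :
    update (asg (x :: l)) 0 y = asg (y :: l) := by
  funext i
  cases i <;> simp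

theorem ClassEmb.map_asg {M : Set ZFSet.{u}} (e : ClassEmb V M) (hM : TransClass M)
    (l : List ZFSet.{u}) : (fun i => e.j (asg l i)) = asg (l.map e.j) := by
  funext i
  have := List.getD_map (f := e.j) (l := l) (n := i) (d := ∅)
  rwa [e.map_empty hM, eq_comm] at this

/-- Elementarity applied to a set defined by separation. -/
theorem ClassEmb.mem_map_sep {M : Set ZFSet.{u}} (e : ClassEmb V M) (hM : TransClass M)
    {φ : Fml} (hφ : φ.good) {I s : ZFSet.{u}} {P : ZFSet.{u} → Prop} (l : List ZFSet.{u})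
    (hP : ∀ x ∈ I, P x ↔ φ.Sat V (asg (x :: I :: ZFSet.sep P I :: l))) (hs : s ∈ e.j I) :
    s ∈ e.j (ZFSet.sep P I) ↔
      φ.Sat M (asg (s :: e.j I :: e.j (ZFSet.sep P I) :: l.map e.j)) := by
  have := e.transfer hM (.ball 0 1 (.iff (.mem 0 2) φ)) (by simpa [good, Fml.iff, imp] using hφ)
    (∅ :: I :: ZFSet.sep P I :: l) (by
      simp only [sat_ball, Fml.sat_iff, update_asg_zero]
      intro x hx
      rw [← hP x hx]
      exact (ZFSet.mem_sep).trans (and_iff_right hx))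
  rw [e.map_asg hM] at this
  simp only [List.map_cons, sat_ball, Fml.sat_iff, update_asg_zero] at this
  exact this s hs

/-- The graph of the restriction of a class function to a set. -/
noncomputable def graph (f : ZFSet.{u} → ZFSet.{u}) (T : ZFSet.{u}) : ZFSet.{u} :=
  ZFSet.range fun x : ↥T => ZFSet.pair x.1 (f x.1)

theorem pair_mem_graph {f : ZFSet.{u} → ZFSet.{u}} {T x y : ZFSet.{u}} :
    ZFSet.pair x y ∈ graph f T ↔ x ∈ T ∧ y = f x := by
  simp only [graph, ZFSet.mem_range, ZFSet.pair_inj]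
  constructor
  · rintro ⟨⟨b, hb⟩, rfl, rfl⟩
    exact ⟨hb, rfl⟩
  · rintro ⟨ha, rfl⟩
    exact ⟨⟨x, ha⟩, rfl, rfl⟩

theorem exists_of_mem_graph {f : ZFSet.{u} → ZFSet.{u}} {T p : ZFSet.{u}} (hp : p ∈ graph f T) :
    ∃ x ∈ T, p = ZFSet.pair x (f x) := by
  obtain ⟨x, rfl⟩ := ZFSet.mem_range.1 hp
  exact ⟨x.1, x.2, rfl⟩

theorem mk_graph_le (f : ZFSet.{u} → ZFSet.{u}) (T : ZFSet.{u}) :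
    Cardinal.mk (graph f T).toSet ≤ Cardinal.mk T.toSet := by
  refine Cardinal.mk_le_of_surjective
    (f := fun x : T.toSet => (⟨_, pair_mem_graph.2 ⟨x.2, rfl⟩⟩ : (graph f T).toSet)) ?_
  rintro ⟨p, hp⟩
  obtain ⟨x, hx, rfl⟩ := exists_of_mem_graph hp
  exact ⟨⟨x, hx⟩, rfl⟩

theorem powerset_mem_vonNeumann {β : Ordinal.{u}} (hβ : Order.IsSuccLimit β) {x : ZFSet.{u}}
    (hx : x ∈ V_ β) : ZFSet.powerset x ∈ V_ β := by
  rw [ZFSet.mem_vonNeumann] at *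
  rw [ZFSet.rank_powerset]
  exact hβ.succ_lt hx

theorem prod_mem_vonNeumann {β : Ordinal.{u}} (hβ : Order.IsSuccLimit β) {x y : ZFSet.{u}}
    (hx : x ∈ V_ β) (hy : y ∈ V_ β) : ZFSet.prod x y ∈ V_ β := by
  refine ZFSet.mem_vonNeumann_of_subset (y := ZFSet.powerset (ZFSet.powerset (x ∪ y)))
    (by unfold ZFSet.prod ZFSet.pairSep; exact ZFSet.sep_subset) ?_
  refine powerset_mem_vonNeumann hβ (powerset_mem_vonNeumann hβ ?_)
  rw [ZFSet.mem_vonNeumann] at *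
  rw [ZFSet.rank_union]
  exact max_lt hx hy

namespace SCEmb

variable {κ θ : ZFSet.{u}} (E : SCEmb κ θ) {I s T : ZFSet.{u}}

/-- The ultrafilter on `I` generated by `s`. -/
noncomputable def ultrafilter (I s : ZFSet.{u}) : ZFSet.{u} :=
  ZFSet.sep (fun X => s ∈ E.e.j X) (ZFSet.powerset I)

theorem mem_ultrafilter {X : ZFSet.{u}} : X ∈ E.ultrafilter I s ↔ X ⊆ I ∧ s ∈ E.e.j X := by
  simp [ultrafilter]

theorem sep_mem_ultrafilter (hs : s ∈ E.e.j I) (φ : Fml) (hφ : φ.good) {P : ZFSet.{u} → Prop}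
    (l : List ZFSet.{u}) (hP : ∀ x ∈ I, P x ↔ φ.Sat V (asg (x :: I :: ZFSet.sep P I :: l)))
    (h : φ.Sat E.M (asg (s :: E.e.j I :: E.e.j (ZFSet.sep P I) :: l.map E.e.j))) :
    ZFSet.sep P I ∈ E.ultrafilter I s :=
  E.mem_ultrafilter.2 ⟨ZFSet.sep_subset, (E.e.mem_map_sep E.trans hφ l hP hs).2 h⟩

theorem isCode_ultrafilter {ℓ A : ZFSet.{u}} (hT : T.IsTransitive)
    (hI : ∀ e ∈ I, ∀ p ∈ e, ∃ b ∈ T, ∃ a ∈ T, p = ZFSet.pair b a)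
    (hs : graph E.e.j T ∈ E.e.j I) (hκT : κ ∈ T) (hAT : A ∈ T) (hA : ZFSet.pair κ A ∈ E.e.j ℓ)
    (hℓ : ∀ δ ∈ κ, ∀ B, ZFSet.pair δ B ∈ ℓ → ZFSet.pair δ B ∈ E.e.j ℓ)
    (hb : ∀ a ∈ T, a.IsOrdinal → a ∈ E.e.j κ) :
    IsCode E.M κ (E.e.j ℓ) T A I (E.ultrafilter I (graph E.e.j T)) where
  sub := hI
  usub X hX e he := (E.mem_ultrafilter.1 hX).1 he
  inter X hX Y hY Z _ hZI hZ := by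
    rw [mem_ultrafilter] at *
    refine ⟨hZI, ?_⟩
    have := E.e.transfer E.trans (.ball 0 1 (.imp (.mem 0 2) (.mem 0 3))) rfl [∅, X, Y, Z]
      (by simpa using hZ)
    simp at this
    exact this _ hX.2 hY.2
  nonempty X hX := by
    obtain ⟨h1, h2⟩ := E.mem_ultrafilter.1 hX
    rcases X.eq_empty_or_nonempty with rfl | ⟨e, he⟩
    · rw [E.e.map_empty E.trans] at h2
      exact (ZFSet.notMem_empty _ h2).elim
    · exact ⟨e, he, h1 he⟩
  ultra X _ hX Y _ hY h := by
    have := E.e.transfer E.trans (.ball 0 1 (.or (.mem 0 2) (.mem 0 3))) rfl [∅, I, X, Y]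
      (by simpa using h)
    simp at this
    exact (this _ hs).imp (fun h => E.mem_ultrafilter.2 ⟨hX, h⟩) fun h => E.mem_ultrafilter.2 ⟨hY, h⟩
  normal f _ X hX h := by
    have := E.e.transfer E.trans (.ball 0 1 (.bex 2 3 (.and (.exFst 4 2 0 (.eq 4 4))
      (.pairMem 0 2 5)))) rfl [∅, X, ∅, T, ∅, f] (by simpa using h)
    simp at this
    obtain ⟨a, ha, ⟨b, hab⟩, hf⟩ := this _ (E.mem_ultrafilter.1 hX).2
    obtain ⟨hbT, rfl⟩ := pair_mem_graph.1 hab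
    refine ⟨b, hbT, ZFSet.sep (fun e => ZFSet.pair e b ∈ f) I, ?_,
      fun e he => (ZFSet.mem_sep.1 he).2⟩
    exact E.sep_mem_ultrafilter hs (.pairMem 0 3 4) rfl [b, f] (by simp) (by simpa using hf)
  fine a ha := by
    refine ⟨ZFSet.sep (fun e => ∃ b, ZFSet.pair b a ∈ e) I, ?_, fun e he => (ZFSet.mem_sep.1 he).2⟩
    refine E.sep_mem_ultrafilter hs (.exFst 4 3 0 (.eq 4 4)) rfl [a] (by simp) ?_
    simp
    exact ⟨a, pair_mem_graph.2 ⟨ha, rfl⟩⟩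
  iso := by
    refine ⟨ZFSet.sep (fun e => ∀ a ∈ T, ∀ b, ZFSet.pair b a ∈ e →
      (∀ b' ∈ b, ∃ a' ∈ T, ZFSet.pair b' a' ∈ e) ∧
      ∀ a' ∈ T, ∀ b', ZFSet.pair b' a' ∈ e → (b' ∈ b ↔ a' ∈ a) ∧ (b' = b ↔ a' = a)) I, ?_,
      fun e he => (ZFSet.mem_sep.1 he).2⟩
    refine E.sep_mem_ultrafilter hs (.ball 8 3 (allFst 9 8 0 (and (ball 10 9 (bex 11 3
      (pairMem 10 11 0))) (ball 11 3 (allFst 10 11 0 (and (iff (mem 10 9) (mem 11 8))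
      (iff (eq 10 9) (eq 11 8)))))))) rfl [T] (by simp) ?_
    simp
    intro a _ b hab
    obtain ⟨hbT, rfl⟩ := pair_mem_graph.1 hab
    refine ⟨fun b' hb' => ⟨E.e.j b', (E.e.mem_iff E.trans).2 (hT.mem_trans hb' hbT),
      pair_mem_graph.2 ⟨hT.mem_trans hb' hbT, rfl⟩⟩, fun a' _ b' hab' => ?_⟩
    obtain ⟨_, rfl⟩ := pair_mem_graph.1 hab'
    exact ⟨(E.e.mem_iff E.trans).symm, (E.e.eq_iff E.trans).symm⟩
  guess := by
    refine ⟨ZFSet.sep (fun e => ∃ δ ∈ κ, ZFSet.pair δ κ ∈ e ∧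
      (∃ B, ZFSet.pair B A ∈ e ∧ ZFSet.pair δ B ∈ ℓ) ∧ ∀ α ∈ δ, ZFSet.pair α α ∈ e) I, ?_, ?_⟩
    · refine E.sep_mem_ultrafilter hs (.bex 8 3 (and (pairMem 8 3 0) (and
        (exFst 9 4 0 (pairMem 8 9 5)) (ball 9 8 (pairMem 9 9 0))))) rfl [κ, A, ℓ] (by simp) ?_
      simp
      refine ⟨κ, E.crit.2.1, pair_mem_graph.2 ⟨hκT, rfl⟩, ⟨A, pair_mem_graph.2 ⟨hAT, rfl⟩, hA⟩,
        fun α hα => pair_mem_graph.2 ⟨hT.mem_trans hα hκT, (E.map_of_mem hα).symm⟩⟩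
    · intro e he
      obtain ⟨_, δ, hδ, h1, ⟨B, hB, hδB⟩, h2⟩ := ZFSet.mem_sep.1 he
      exact ⟨δ, hδ, h1, ⟨B, hB, hℓ δ hδ B hδB⟩, h2⟩
  bound a ha hao := by
    refine ⟨ZFSet.sep (fun e => ∃ δ ∈ κ, ZFSet.pair δ a ∈ e) I, ?_,
      fun e he => (ZFSet.mem_sep.1 he).2⟩
    refine E.sep_mem_ultrafilter hs (.bex 5 3 (.pairMem 5 4 0)) rfl [κ, a] (by simp) ?_
    simp
    exact ⟨a, hb a ha hao, pair_mem_graph.2 ⟨ha, rfl⟩⟩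

theorem exists_code {β : Ordinal.{u}} (hβ : Cardinal.mk (V_ β).toSet ≤ Cardinal.mk θ.toSet)
    (hlim : Order.IsSuccLimit β) {α ℓ A : ZFSet.{u}} (hα : α ∈ E.e.j κ) (hαβ : α.rank < β)
    (hT : ZFSet.pair α T ∈ E.e.j (hier κ)) (hκT : κ ∈ T) (hAT : A ∈ T)
    (hA : ZFSet.pair κ A ∈ E.e.j ℓ) (hℓ : IsPFun κ ℓ) :
    ∃ I ∈ E.M, ∃ U ∈ E.M, IsCode E.M κ (E.e.j ℓ) T A I U := by
  have hjκ := E.e.isOrdinal E.trans E.crit.1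
  obtain rfl := E.eq_vonNeumann_of_pair_mem_hier hβ hα hαβ.le hT
  have hM : ∀ x ∈ V_ β, x ∈ E.M := fun x => E.mem_of_mem_vonNeumann hβ
  have hκα : κ.rank < α.rank := ZFSet.mem_vonNeumann.1 hκT
  have hκβ : κ.rank ≤ β := (hκα.trans hαβ).le
  have hTt := ZFSet.isTransitive_vonNeumann α.rank
  have hTβ : V_ α.rank ∈ V_ β := ZFSet.vonNeumann_mem_of_lt hαβ
  set T := V_ α.rank with hTdef
  have hWT : V_ κ.rank ⊆ T := ZFSet.vonNeumann_subset_of_le hκα.le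
  have hWβ : V_ κ.rank ∈ V_ β := ZFSet.vonNeumann_mem_of_lt (hκα.trans hαβ)
  let I := ZFSet.powerset (ZFSet.prod (V_ κ.rank) T)
  have hIβ : I ∈ V_ β := powerset_mem_vonNeumann hlim (prod_mem_vonNeumann hlim hWβ hTβ)
  have hUβ : E.ultrafilter I (graph E.e.j T) ∈ V_ β :=
    ZFSet.mem_vonNeumann_of_subset ZFSet.sep_subset (powerset_mem_vonNeumann hlim hIβ)
  refine ⟨I, hM _ hIβ, _, hM _ hUβ, E.isCode_ultrafilter hTt ?_ ?_ hκT hAT hA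
    (fun δ hδ B hB => (E.pair_mem_map_pfun hβ hκβ hℓ hδ).2 hB) ?_⟩
  · intro e he p hp
    obtain ⟨b, hb, a, ha, rfl⟩ := ZFSet.mem_prod.1 (ZFSet.mem_powerset.1 he hp)
    exact ⟨b, hWT hb, a, ha, rfl⟩
  · have hsM : graph E.e.j T ∈ E.M := by
      refine E.mem_of_card_le (fun p hp => ?_) ((mk_graph_le _ _).trans ((mk_mono ?_).trans hβ))
      · obtain ⟨x, hx, rfl⟩ := exists_of_mem_graph hp
        exact E.e.pair_mem E.trans (E.trans _ (hM _ hTβ) _ hx) (E.e.maps _ (mem_V _))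
      · exact (ZFSet.isTransitive_vonNeumann β).subset_of_mem hTβ
    have := E.e.transfer E.trans (.all 0 (.imp (.ball 4 0 (.bex 5 1 (.bex 6 2 (.eqPair 4 5 6))))
      (.mem 0 3))) rfl [∅, V_ κ.rank, T, I] (by
        simp
        intro e he
        refine ZFSet.mem_powerset.2 fun p hp => ZFSet.mem_prod.2 ?_
        obtain ⟨b, hb, a, ha, rfl⟩ := he p hp
        exact ⟨b, hb, a, ha, rfl⟩)
    simp at this
    refine this _ hsM fun p hp => ?_
    obtain ⟨x, hx, rfl⟩ := exists_of_mem_graph hp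
    exact ⟨x, E.subset_map_vonNeumann hα hT hx, _, (E.e.mem_iff E.trans).2 hx, rfl⟩
  · intro a ha hao
    refine hjκ.mem_trans ?_ hα
    rw [← hao.rank_lt_iff_mem (hjκ.mem hα)]
    exact ZFSet.mem_vonNeumann.1 ha

end SCEmb

end

section

open Function Fml
open scoped ZFSet

/-! ### The Laver function -/

theorem IsCode.congr {M : Set ZFSet.{u}} {γ ℓ ℓ' T A I U : ZFSet.{u}} (h : IsCode M γ ℓ T A I U)
    (hℓ : ∀ δ ∈ γ, ∀ B, ZFSet.pair δ B ∈ ℓ → ZFSet.pair δ B ∈ ℓ') : IsCode M γ ℓ' T A I U :=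
  { h with
    guess := by
      obtain ⟨X, hX, hg⟩ := h.guess
      refine ⟨X, hX, fun e he => ?_⟩
      obtain ⟨δ, hδ, h1, ⟨B, hB, hδB⟩, h2⟩ := hg e he
      exact ⟨δ, hδ, h1, ⟨B, hB, hℓ δ hδ B hδB⟩, h2⟩ }

/-- Being a code is absolute between the universe and classes containing a large enough `V_ β`. -/
theorem IsCode.to_V {M : Set ZFSet.{u}} {γ ℓ T A I U : ZFSet.{u}} (h : IsCode M γ ℓ T A I U)
    {β : Ordinal.{u}} (hβ : Order.IsSuccLimit β) (hM : ∀ x ∈ V_ β, x ∈ M) (hT : T ∈ V_ β) :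
    IsCode V γ ℓ T A I U := by
  have hI : I ∈ V_ β := by
    refine ZFSet.mem_vonNeumann_of_subset (fun e he => ?_)
      (powerset_mem_vonNeumann hβ (prod_mem_vonNeumann hβ hT hT))
    exact ZFSet.mem_powerset.2 fun p hp => ZFSet.mem_prod.2 (h.sub e he p hp)
  have hsub : ∀ Z : ZFSet.{u}, (∀ e ∈ Z, e ∈ I) → Z ∈ M := fun Z hZ =>
    hM Z (ZFSet.mem_vonNeumann_of_subset (fun e he => hZ e he) hI)
  refine { h with
    inter := fun X hX Y hY Z _ hZ => h.inter X hX Y hY Z (hsub Z hZ) hZ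
    ultra := fun X _ hX Y _ hY => h.ultra X (hsub X hX) hX Y (hsub Y hY) hY
    normal := fun f _ X hX hf => ?_ }
  obtain ⟨a, ha, Y, hY, hYf⟩ := h.normal (ZFSet.sep (fun p => p ∈ f) (ZFSet.prod I T))
    (hM _ (ZFSet.mem_vonNeumann_of_subset ZFSet.sep_subset (prod_mem_vonNeumann hβ hI hT))) X hX
    (fun e he => by
      obtain ⟨a, ha, hea, hf⟩ := hf e he
      exact ⟨a, ha, hea, ZFSet.mem_sep.2 ⟨ZFSet.pair_mem_prod.2 ⟨h.usub X hX e he, ha⟩, hf⟩⟩)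
  exact ⟨a, ha, Y, hY, fun e he => (ZFSet.mem_sep.1 (hYf e he)).2⟩

/-- Relative to `M`, there is no code for an embedding with critical point `γ` that guesses `A`
correctly. -/
def Bad (M : Set ZFSet.{u}) (γ ℓ T A : ZFSet.{u}) : Prop :=
  γ ∈ T ∧ A ∈ T ∧ ¬ ∃ I ∈ M, ∃ U ∈ M, IsCode M γ ℓ T A I U

theorem Bad.congr {M : Set ZFSet.{u}} {γ ℓ ℓ' T A : ZFSet.{u}} (h : Bad M γ ℓ T A)
    (hℓ : ∀ δ ∈ γ, ∀ B, ZFSet.pair δ B ∈ ℓ' → ZFSet.pair δ B ∈ ℓ) : Bad M γ ℓ' T A :=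
  ⟨h.1, h.2.1, fun ⟨I, hI, U, hU, hc⟩ => h.2.2 ⟨I, hI, U, hU, hc.congr hℓ⟩⟩

/-- The formula expressing `Bad`, with free variables `0, …, 3`. -/
def Fml.bad : Fml := and (mem 0 2) (and (mem 3 2) (neg (ex 4 (ex 5 code))))

theorem Fml.sat_bad (M : Set ZFSet.{u}) (v : ℕ → ZFSet.{u}) :
    bad.Sat M v ↔ Bad M (v 0) (v 1) (v 2) (v 3) := by
  simp [bad, Bad, sat_code]

/-- The set of pairs `(δ, B)` with `δ ∈ γ` and `B ∈ F δ`. -/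
noncomputable def glue (γ : ZFSet.{u}) (F : ↥γ → ZFSet.{u}) : ZFSet.{u} :=
  ⋃₀ (ZFSet.range fun δ : ↥γ => ZFSet.prod {δ.1} (F δ) : ZFSet)

theorem mem_glue {γ p : ZFSet.{u}} {F : ↥γ → ZFSet.{u}} :
    p ∈ glue γ F ↔ ∃ δ : ↥γ, ∃ B ∈ F δ, p = ZFSet.pair δ.1 B := by
  simp [glue]

theorem pair_mem_glue {γ δ B : ZFSet.{u}} {F : ↥γ → ZFSet.{u}} :
    ZFSet.pair δ B ∈ glue γ F ↔ ∃ h : δ ∈ γ, B ∈ F ⟨δ, h⟩ := by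
  rw [mem_glue]
  constructor
  · rintro ⟨δ', B', hB, h⟩
    obtain ⟨rfl, rfl⟩ := ZFSet.pair_inj.1 h
    exact ⟨δ'.2, hB⟩
  · rintro ⟨h, hB⟩
    exact ⟨_, B, hB, rfl⟩

/-- `A` is a counterexample at `γ` of minimal rank below `κ` for the partial function `r`. -/
def IsLeastBad (κ γ r A : ZFSet.{u}) : Prop :=
  ∃ α ∈ κ, Bad V γ r (V_ α.rank) A ∧ ∀ α' ∈ α, ∀ A', ¬ Bad V γ r (V_ α'.rank) A'

open Classical in
/-- The singleton of a minimal counterexample, if there is one, and the empty set otherwise. -/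
noncomputable def leastBad (κ γ r : ZFSet.{u}) : ZFSet.{u} :=
  if h : ∃ A, IsLeastBad κ γ r A then {h.choose} else ∅

theorem isLeastBad_of_mem {κ γ r A : ZFSet.{u}} (h : A ∈ leastBad κ γ r) :
    IsLeastBad κ γ r A := by
  unfold leastBad at h
  split_ifs at h with h'
  · rw [ZFSet.mem_singleton.1 h]
    exact h'.choose_spec
  · exact (ZFSet.notMem_empty _ h).elim

theorem leastBad_subsingleton {κ γ r A B : ZFSet.{u}} (hA : A ∈ leastBad κ γ r)
    (hB : B ∈ leastBad κ γ r) : A = B := by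
  unfold leastBad at hA hB
  split_ifs at hA hB
  · rw [ZFSet.mem_singleton.1 hA, ZFSet.mem_singleton.1 hB]
  · exact (ZFSet.notMem_empty _ hA).elim

theorem exists_mem_leastBad {κ γ r α A : ZFSet.{u}} (hκ : κ.IsOrdinal) (hα : α ∈ κ)
    (hA : Bad V γ r (V_ α.rank) A) : ∃ B, B ∈ leastBad κ γ r := by
  have h : ∃ A, IsLeastBad κ γ r A := by
    induction α using ZFSet.inductionOn generalizing A with
    | _ α ih =>
    by_cases hex : ∃ α' ∈ α, ∃ A', Bad V γ r (V_ α'.rank) A'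
    · obtain ⟨α', hα', A', hA'⟩ := hex
      exact ih α' hα' (hκ.mem_trans hα' hα) hA'
    · push Not at hex
      exact ⟨A, α, hα, hA, hex⟩
  exact ⟨h.choose, by rw [leastBad, dif_pos h]; exact ZFSet.mem_singleton.2 rfl⟩

/-- The values of the Laver function, as sets with at most one element. -/
noncomputable def laverVal (κ : ZFSet.{u}) : ZFSet.{u} → ZFSet.{u} :=
  ZFSet.mem_wf.fix fun γ F => leastBad κ γ (glue γ fun δ => F δ.1 δ.2)

theorem laverVal_eq (κ γ : ZFSet.{u}) :
    laverVal κ γ = leastBad κ γ (glue γ fun δ => laverVal κ δ.1) :=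
  ZFSet.mem_wf.fix_eq _ _

/-- The Laver function on `κ`. -/
noncomputable def laver (κ : ZFSet.{u}) : ZFSet.{u} := glue κ fun δ => laverVal κ δ.1

theorem isPFun_laver (κ : ZFSet.{u}) : IsPFun κ (laver κ) := by
  constructor
  · intro p hp
    obtain ⟨δ, B, hB, rfl⟩ := mem_glue.1 hp
    refine ⟨δ.1, B, δ.2, ?_, rfl⟩
    rw [laverVal_eq] at hB
    obtain ⟨α, hα, h, -⟩ := isLeastBad_of_mem hB
    exact (ZFSet.mem_vonNeumann.1 h.2.1).trans (ZFSet.rank_lt_of_mem hα)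
  · intro γ A B hA hB
    obtain ⟨_, hA⟩ := pair_mem_glue.1 hA
    obtain ⟨_, hB⟩ := pair_mem_glue.1 hB
    rw [laverVal_eq] at hA hB
    exact leastBad_subsingleton hA hB

theorem exists_pair_mem_laver {κ γ α A : ZFSet.{u}} (hκ : κ.IsOrdinal) (hγ : γ ∈ κ) (hα : α ∈ κ)
    (hA : Bad V γ (laver κ) (V_ α.rank) A) :
    ∃ α' ∈ κ, (α' ∈ α ∨ α' = α) ∧ ∃ A', Bad V γ (laver κ) (V_ α'.rank) A' ∧
      ZFSet.pair γ A' ∈ laver κ := by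
  have hpair : ∀ δ ∈ γ, ∀ B, ZFSet.pair δ B ∈ laver κ ↔
      ZFSet.pair δ B ∈ glue γ fun δ => laverVal κ δ.1 := by
    intro δ hδ B
    rw [laver, pair_mem_glue, pair_mem_glue]
    exact ⟨fun ⟨_, h⟩ => ⟨hδ, h⟩, fun ⟨_, h⟩ => ⟨hκ.mem_trans hδ hγ, h⟩⟩
  have hA' := hA.congr fun δ hδ B => (hpair δ hδ B).2
  obtain ⟨B, hB⟩ := exists_mem_leastBad hκ hα hA'
  obtain ⟨α', hα', hbad, hmin⟩ := isLeastBad_of_mem hB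
  refine ⟨α', hα', ?_, B, hbad.congr fun δ hδ B => (hpair δ hδ B).1, ?_⟩
  · rcases (hκ.mem hα').mem_trichotomous (hκ.mem hα) with h | h | h
    · exact .inl h
    · exact .inr h
    · exact (hmin α h A hA').elim
  · rw [← laverVal_eq] at hB
    exact pair_mem_glue.2 ⟨hγ, hB⟩

theorem SCEmb.exists_pair_mem_map_laver {κ θ : ZFSet.{u}} (E : SCEmb κ θ) {α T A : ZFSet.{u}}
    (hα : α ∈ E.e.j κ) (hT : ZFSet.pair α T ∈ E.e.j (hier κ))
    (hA : Bad E.M κ (E.e.j (laver κ)) T A) :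
    ∃ α' ∈ E.e.j κ, (α' ∈ α ∨ α' = α) ∧ ∃ T', ZFSet.pair α' T' ∈ E.e.j (hier κ) ∧
      ∃ A', Bad E.M κ (E.e.j (laver κ)) T' A' ∧ ZFSet.pair κ A' ∈ E.e.j (laver κ) := by
  have := E.e.transfer E.trans (.ball 0 12 (.ball 14 12 (.all 2 (.imp (.pairMem 14 2 13)
    (.ball 3 2 (.imp bad (.bex 15 12 (.and (.or (.mem 15 14) (.eq 15 14))
      (.ex 2 (.and (.pairMem 15 2 13) (.bex 3 2 (.and bad (.pairMem 0 3 1)))))))))))))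
    rfl [∅, laver κ, ∅, ∅, ∅, ∅, ∅, ∅, ∅, ∅, ∅, ∅, κ, hier κ] (by
      simp [sat_bad, pair_mem_hier]
      intro γ hγ α hα A _ hA
      obtain ⟨α', hα', h, A', hA', hp⟩ := exists_pair_mem_laver E.crit.1 hγ hα hA
      exact ⟨α', hα', h, hα', A', hA'.2.1, hA', hp⟩)
  simp [sat_bad] at this
  have hTM := (E.trans.of_pair (E.trans _ (E.e.maps (hier κ) (mem_V _)) _ hT)).2
  obtain ⟨α', h1, h2, T', -, h3, A', -, h4, h5⟩ :=
    this κ E.crit.2.1 α hα T hTM hT A hA.2.1 hA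
  exact ⟨α', h1, h2, T', h3, A', h4, h5⟩

theorem mk_toSet (x : ZFSet.{u}) : Cardinal.mk x.toSet = Cardinal.lift.{u + 1} x.card :=
  ZFSet.cardinalMk_coe_sort

theorem isCard_toZFSet_ord (c : Cardinal.{u}) : IsCard c.ord.toZFSet := by
  refine ⟨ZFSet.isOrdinal_toZFSet _, fun b hb => ?_⟩
  obtain ⟨a, ha, rfl⟩ := Ordinal.mem_toZFSet_iff.1 hb
  rw [mk_toSet, mk_toSet, Cardinal.lift_lt, Ordinal.card_toZFSet, Ordinal.card_toZFSet,
    Cardinal.card_ord]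
  exact Cardinal.lt_ord.1 ha

theorem Supercompact.ldscFun_laver {κ : ZFSet.{u}} (h : Supercompact κ) :
    LDscFun κ (laver κ) := by
  refine ⟨isPFun_laver κ, fun θ A hθ _ => ?_⟩
  by_contra hno
  let a : Ordinal.{u} := Order.succ (max κ.rank (max θ.rank A.rank))
  let β : Ordinal.{u} := a + Ordinal.omega0
  let c : Cardinal.{u} := Order.succ (V_ β).card
  obtain ⟨E⟩ := h c.ord.toZFSet (isCard_toZFSet_ord c)
  have hβ : Cardinal.mk (V_ β).toSet ≤ Cardinal.mk c.ord.toZFSet.toSet := by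
    rw [mk_toSet, mk_toSet, Cardinal.lift_le, Ordinal.card_toZFSet, Cardinal.card_ord]
    exact Order.le_succ _
  have hlim : Order.IsSuccLimit β := Ordinal.isSuccLimit_add a Ordinal.isSuccLimit_omega0
  have haβ : a < β := lt_add_of_pos_right a Ordinal.omega0_pos
  have hjκ := E.e.isOrdinal E.trans E.crit.1
  have ha : a.toZFSet ∈ E.e.j κ := by
    refine hjκ.mem_trans (Ordinal.toZFSet_mem_toZFSet_iff.2 ?_) E.big
    rw [Cardinal.lt_ord, Order.lt_succ_iff]
    exact (Ordinal.card_le_card haβ.le).trans β.card_le_card_vonNeumann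
  have hmem : ∀ x : ZFSet.{u}, x.rank ≤ max κ.rank (max θ.rank A.rank) → x ∈ V_ a := fun x hx =>
    ZFSet.mem_vonNeumann.2 (Order.lt_succ_of_le hx)
  have hκT := hmem κ (le_max_left _ _)
  have hAT := hmem A (le_max_of_le_right (le_max_right _ _))
  have hκβ : κ.rank ≤ β := ((ZFSet.mem_vonNeumann.1 hκT).trans haβ).le
  obtain ⟨T, hT⟩ := E.exists_pair_mem_hier ha
  obtain rfl := E.eq_vonNeumann_of_pair_mem_hier hβ ha
    (by rw [Ordinal.rank_toZFSet]; exact haβ.le) hT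
  rw [Ordinal.rank_toZFSet] at hT
  have hbad : Bad E.M κ (E.e.j (laver κ)) (V_ a) A := by
    refine ⟨hκT, hAT, fun ⟨I, _, U, _, hc⟩ => hno ?_⟩
    have hc' := (hc.congr fun δ hδ B =>
      (E.pair_mem_map_pfun hβ hκβ (isPFun_laver κ) hδ).1).to_V hlim
      (fun x => E.mem_of_mem_vonNeumann hβ) (ZFSet.vonNeumann_mem_of_lt haβ)
    exact hc'.exists_emb (ZFSet.isTransitive_vonNeumann a) E.crit.1 hκT E.omega_mem hAT
      (hmem θ (le_max_of_le_right (le_max_left _ _))) hθ.1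
  obtain ⟨α', hα', hle, T', hT', A', hA', hp⟩ := E.exists_pair_mem_map_laver ha hT hbad
  refine hA'.2.2 (E.exists_code hβ hlim hα' ?_ hT' hA'.1 hA'.2.1 hp (isPFun_laver κ))
  rcases hle with h | rfl
  · exact (ZFSet.rank_lt_of_mem h).trans (by rwa [Ordinal.rank_toZFSet])
  · rwa [Ordinal.rank_toZFSet]

end

end LaverDiamond

open LaverDiamond

/-- **(Laver)** If `κ` is a supercompact cardinal, then the Laver diamond principle
`LD^sc_κ` holds: there is a partial function `ℓ : κ ⇀ V_κ` such that for every cardinal `θ`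
and every set `A ∈ H(θ⁺)` there is a `θ`-supercompactness embedding `j : V → M` with
critical point `κ` such that `j(ℓ)(κ) = A`. -/
theorem laver_LDsc_of_supercompact (κ : ZFSet.{u}) (h : Supercompact κ) :
    LDsc κ := by
  exact ⟨_, h.ldscFun_laver⟩
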